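/- arXiv:1611.02021 — 2 statements merged into one kernel-verified Lean document; each statement's English description precedes it below -/
import Mathlib

section
/- Let X be a subset of {0,1}^k whose cardinality is a power of 2. Then there exists a positive integer n such that {0,1}^n can be partitioned into isometric copies of X. -/
namespace HC
open Function Classical

abbrev Q (ι : Type) := ι → ZMod 2

def IsTile {k : ℕ} (X : Finset (Q (Fin k))) {ι : Type} (T : Set (Q ι)) : Prop :=
  ∃ g : Fin k → ι, Injective g ∧ ∃ (z : Q ι) (c : Q (Fin k)),
    T = {w | w ∘ g + c ∈ X ∧ ∀ i, i ∉ Set.range g → w i = z i}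

def Til {k : ℕ} (X : Finset (Q (Fin k))) {ι : Type} (R : Set (Q ι)) : Prop :=
  ∃ f : Q ι → Set (Q ι), ∀ x ∈ R, IsTile X (f x) ∧ x ∈ f x ∧ f x ⊆ R ∧ ∀ y ∈ f x, f y = f x

variable {k : ℕ} {X : Finset (Q (Fin k))} {ι κ : Type}

lemma til_empty : Til X (∅ : Set (Q ι)) := ⟨fun _ => ∅, by simp⟩

lemma til_ite {R : Set (Q ι)} (p : Prop) (h : p → Til X R) : Til X {x | p ∧ x ∈ R} := by
  by_cases hp : p
  · simpa [hp] using h hp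
  · simpa [hp] using til_empty

lemma IsTile.til {T : Set (Q ι)} (h : IsTile X T) : Til X T :=
  ⟨fun _ => T, fun x hx => ⟨h, hx, subset_rfl, fun _ _ => rfl⟩⟩

lemma til_cls {β : Type*} (c : Q ι → β) {R : Set (Q ι)} (h : ∀ b, Til X {x | x ∈ R ∧ c x = b}) :
    Til X R := by
  choose f hf using h
  refine ⟨fun x => f (c x) x, fun x hx => ?_⟩
  obtain ⟨h1, h2, h3, h4⟩ := hf (c x) x ⟨hx, rfl⟩
  refine ⟨h1, h2, fun y hy => (h3 hy).1, fun y hy => ?_⟩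
  have := (h3 hy).2
  simp only [this]
  exact h4 y hy

lemma til_iUnion {β : Type*} {R : β → Set (Q ι)} (h : ∀ b, Til X (R b))
    (hd : ∀ a b x, x ∈ R a → x ∈ R b → a = b) : Til X (⋃ b, R b) := by
  apply til_cls (fun x => if h : ∃ b, x ∈ R b then some h.choose else none)
  rintro (_ | b)
  · convert til_empty using 1
    ext x; simp
  · convert h b using 1
    ext x
    simp only [Set.mem_iUnion, Set.mem_ofPred_eq]
    constructor
    · rintro ⟨hx, h2⟩
      rw [dif_pos hx] at h2
      have := hx.choose_spec
      simp at h2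
      rwa [h2] at this
    · intro hx
      have h' : ∃ b, x ∈ R b := ⟨b, hx⟩
      refine ⟨h', ?_⟩
      rw [dif_pos h']
      exact congrArg some (hd _ _ x h'.choose_spec hx)

lemma til_slice {g : ι → κ} (hg : Injective g) {R : Set (Q κ)}
    (h : ∀ z, Til X {x : Q ι | extend g x z ∈ R}) : Til X R := by
  have : ∃ F : Set (Q ι) → Q ι → Set (Q ι), ∀ S, Til X S → ∀ x ∈ S,
      IsTile X (F S x) ∧ x ∈ F S x ∧ F S x ⊆ S ∧ ∀ y ∈ F S x, F S y = F S x := by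
    refine ⟨fun S => if h : Til X S then h.choose else fun _ => ∅, fun S hS => ?_⟩
    simp only [dif_pos hS]
    exact hS.choose_spec
  obtain ⟨F, hF⟩ := this
  have hext : ∀ (w z : Q κ), (∀ j, j ∉ Set.range g → w j = z j) → extend g (w ∘ g) z = w := by
    intro w z hw
    ext j
    by_cases hj : j ∈ Set.range g
    · obtain ⟨i, rfl⟩ := hj
      rw [hg.extend_apply]; rfl
    · rw [extend_apply' _ _ _ (by simpa using hj), hw j hj]
  have hext2 : ∀ (w z : Q κ), (∀ j, j ∉ Set.range g → w j = z j) → ∀ x : Q ι,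
      extend g x w = extend g x z := by
    intro w z hw x
    ext j
    by_cases hj : j ∈ Set.range g
    · obtain ⟨i, rfl⟩ := hj
      rw [hg.extend_apply, hg.extend_apply]
    · rw [extend_apply' _ _ _ (by simpa using hj), extend_apply' _ _ _ (by simpa using hj), hw j hj]
  refine ⟨fun z => {w | (∀ j, j ∉ Set.range g → w j = z j) ∧
    w ∘ g ∈ F {x | extend g x z ∈ R} (z ∘ g)}, fun z hz => ?_⟩
  have hzz : z ∘ g ∈ {x | extend g x z ∈ R} := by
    simp only [Set.mem_ofPred_eq]
    rwa [hext z z (fun _ _ => rfl)]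
  obtain ⟨h1, h2, h3, h4⟩ := hF _ (h z) _ hzz
  refine ⟨?_, ⟨fun _ _ => rfl, h2⟩, ?_, ?_⟩
  · obtain ⟨g', hg', z', c, hT⟩ := h1
    refine ⟨g ∘ g', hg.comp hg', extend g z' z, c, ?_⟩
    beta_reduce
    rw [hT]
    ext w
    simp only [Set.mem_ofPred_eq]
    constructor
    · rintro ⟨a1, a2, a3⟩
      refine ⟨a2, fun j hj => ?_⟩
      by_cases hj' : j ∈ Set.range g
      · obtain ⟨i, rfl⟩ := hj'
        rw [hg.extend_apply]
        apply a3
        rintro ⟨l, rfl⟩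
        exact hj ⟨l, rfl⟩
      · rw [extend_apply' _ _ _ (by simpa using hj'), a1 j hj']
    · rintro ⟨a2, a3⟩
      refine ⟨fun j hj => ?_, a2, fun i hi => ?_⟩
      · rw [a3 j, extend_apply' _ _ _ (by simpa using hj)]
        rintro ⟨l, rfl⟩
        exact hj ⟨g' l, rfl⟩
      · have := a3 (g i)
        rw [hg.extend_apply] at this
        apply this
        rintro ⟨l, hl⟩
        exact hi ⟨l, hg hl⟩
  · rintro w ⟨a1, a2⟩
    have := h3 a2
    simp only [Set.mem_ofPred_eq] at this
    rwa [hext w z a1] at this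
  · rintro w ⟨a1, a2⟩
    have e1 : {x : Q ι | extend g x w ∈ R} = {x | extend g x z ∈ R} := by
      ext x; simp only [Set.mem_ofPred_eq, hext2 w z a1]
    ext v
    simp only [Set.mem_ofPred_eq, e1, h4 _ a2]
    refine and_congr_left fun _ => forall_congr' fun j => forall_congr' fun hj => ?_
    rw [a1 j hj]

lemma til_sliceL {R : Set (Q (ι ⊕ κ))}
    (h : ∀ y : Q κ, Til X {x : Q ι | Sum.elim x y ∈ R}) : Til X R := by
  apply til_slice Sum.inl_injective
  intro z
  convert h (z ∘ Sum.inr) using 3 with x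
  congr! 1
  ext (i | i)
  · rw [Sum.inl_injective.extend_apply]; rfl
  · rw [extend_apply' _ _ _ (by simp)]; rfl

lemma til_sliceR {R : Set (Q (ι ⊕ κ))}
    (h : ∀ x : Q ι, Til X {y : Q κ | Sum.elim x y ∈ R}) : Til X R := by
  apply til_slice Sum.inr_injective
  intro z
  convert h (z ∘ Sum.inl) using 3 with x
  congr! 1
  ext (i | i)
  · rw [extend_apply' _ _ _ (by simp)]; rfl
  · rw [Sum.inr_injective.extend_apply]; rfl

lemma IsTile.translate {T : Set (Q ι)} (h : IsTile X T) (v : Q ι) : IsTile X {x | x + v ∈ T} := by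
  obtain ⟨g, hg, z, c, rfl⟩ := h
  refine ⟨g, hg, z - v, c + v ∘ g, ?_⟩
  ext w
  simp only [Set.mem_ofPred_eq, Pi.add_apply, Pi.sub_apply, eq_sub_iff_add_eq]
  have : (w + v) ∘ g + c = w ∘ g + (c + v ∘ g) := by
    ext i; simp; ring
  rw [this]

lemma Til.translate {R : Set (Q ι)} (h : Til X R) (v : Q ι) : Til X {x | x + v ∈ R} := by
  obtain ⟨f, hf⟩ := h
  refine ⟨fun x => {y | y + v ∈ f (x + v)}, fun x hx => ?_⟩
  obtain ⟨h1, h2, h3, h4⟩ := hf _ hx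
  refine ⟨h1.translate v, h2, fun y hy => h3 hy, fun y hy => ?_⟩
  simp only [h4 _ hy]

/-- complement of a product of leftovers -/
lemma til_pow {M : Type} (H : M → Set (Q ι)) (hH : ∀ m, Til X (H m)) :
    Til X {x : Q (M × ι) | ∃ m, (fun i => x (m, i)) ∈ H m} := by
  set r : M → M → Prop := WellOrderingRel with hr
  have wf : WellFounded r := IsWellFounded.wf
  have heq : {x : Q (M × ι) | ∃ m, (fun i => x (m, i)) ∈ H m} =
      ⋃ m, {x : Q (M × ι) | (fun i => x (m, i)) ∈ H m ∧
      ∀ m', r m' m → (fun i => x (m', i)) ∉ H m'} := by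
    ext x
    simp only [Set.mem_iUnion, Set.mem_ofPred_eq]
    constructor
    · intro h
      refine ⟨wf.min {m | (fun i => x (m, i)) ∈ H m} h, wf.min_mem {m | (fun i => x (m, i)) ∈ H m} h, ?_⟩
      intro m' hm' h'
      exact wf.not_lt_min {m | (fun i => x (m, i)) ∈ H m} h' hm'
    · rintro ⟨m, h, -⟩; exact ⟨m, h⟩
  rw [heq]
  apply til_iUnion
  · intro m
    have hinj : Injective (fun i : ι => (m, i)) := fun a b h => by simpa using h
    apply til_slice hinj
    intro z
    convert til_ite (X := X) (R := H m) (∀ m', r m' m → (fun i => z (m', i)) ∉ H m')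
      (fun _ => hH m) using 1
    ext u
    simp only [Set.mem_ofPred_eq]
    rw [and_comm]
    have e1 : (fun i => extend (fun i : ι => (m, i)) u z (m, i)) = u := by
      ext i
      exact hinj.extend_apply u z i
    rw [e1]
    refine and_congr_left fun _ => forall_congr' fun m' => forall_congr' fun hm' => ?_
    have hne : m' ≠ m := by
      rintro rfl
      exact wf.irrefl.irrefl _ hm'
    have e2 : (fun i => extend (fun i : ι => (m, i)) u z (m', i)) = fun i => z (m', i) := by
      ext i
      exact extend_apply' _ _ _ (by rintro ⟨a, ha⟩; simp at ha; exact hne ha.1.symm)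
    rw [e2]
  · rintro a b x ⟨ha, ha'⟩ ⟨hb, hb'⟩
    rcases trichotomous_of r a b with h | h | h
    · exact absurd ha (hb' _ h)
    · exact h
    · exact absurd hb (ha' _ h)

end HC

namespace HC
open Function Classical
variable {k : ℕ} {X : Finset (Q (Fin k))} {ι κ : Type}

/-- first step: a tileable set meeting every ball of radius one -/
lemma step1 (h0 : (0 : Q (Fin k)) ∈ X) : ∃ (C1 : Set (Q ((Q (Fin k)) ⊕ Fin k))), Til X C1 ∧
    ∀ p : Q ((Q (Fin k)) ⊕ Fin k), ∃ h : (Q (Fin k)) ⊕ Fin k,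
      p + (Pi.single h 1 : Q ((Q (Fin k)) ⊕ Fin k)) ∈ C1 := by
  let c : Q ((Q (Fin k)) ⊕ Fin k) → Q (Fin k) := fun p => ∑ h, p (Sum.inl h) • h
  refine ⟨{p | p ∘ Sum.inr + c p ∈ X}, ?_, ?_⟩
  · apply til_sliceR
    intro x
    apply IsTile.til
    refine ⟨id, injective_id, 0, ∑ h, x h • h, ?_⟩
    ext w
    simp [c]
  · intro p
    refine ⟨Sum.inl (p ∘ Sum.inr + c p), ?_⟩
    show _ ∈ X
    convert h0 using 1
    have e1 : (p + Pi.single (Sum.inl (p ∘ Sum.inr + c p)) (1 : ZMod 2)) ∘ Sum.inr = p ∘ Sum.inr := by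
      ext i; simp
    have e2 : c (p + Pi.single (Sum.inl (p ∘ Sum.inr + c p)) (1 : ZMod 2)) = c p + (p ∘ Sum.inr + c p) := by
      simp only [c, Pi.add_apply, add_smul, Finset.sum_add_distrib]
      congr 1
      rw [Finset.sum_eq_single (p ∘ Sum.inr + ∑ h, p (Sum.inl h) • h)]
      · simp
      · intro b _ hb
        rw [Pi.single_eq_of_ne (by simpa using hb), zero_smul]
      · simp
    rw [e1, e2]
    ext i
    simp only [Pi.add_apply, Pi.zero_apply]
    generalize (p ∘ Sum.inr) i = a
    generalize c p i = b
    revert a b; decide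

lemma step2 (h0 : (0 : Q (Fin k)) ∈ X) : ∃ (ι : Type) (_ : Fintype ι) (B : Set (Q ι))
    (T : Q ι → Set (Q ι)), Til X Bᶜ ∧ ∀ b ∈ B, IsTile X (T b) ∧ b ∈ T b ∧ ∀ w ∈ T b, w ∈ B → w = b := by
  obtain ⟨C1, hC, hh⟩ := step1 h0
  choose h hh using hh
  refine ⟨Fin k × ((Q (Fin k)) ⊕ Fin k), inferInstance, {p | ∀ j, (fun i => p (j, i)) ∉ C1},
    fun b => {w | w ∘ (fun j => (j, h (fun i => b (j, i)))) + b ∘ (fun j => (j, h (fun i => b (j, i)))) ∈ X ∧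
      ∀ i, i ∉ Set.range (fun j => (j, h (fun i => b (j, i)))) → w i = b i}, ?_, ?_⟩
  · convert til_pow (fun _ : Fin k => C1) (fun _ => hC) using 1
    ext x
    simp
  · intro b hb
    refine ⟨⟨_, fun i j hij => (by simpa using hij : _ ∧ _).1, _, _, rfl⟩, ⟨?_, fun _ _ => rfl⟩, ?_⟩
    · convert h0 using 1
      ext i
      exact CharTwo.add_self_eq_zero _
    · rintro w ⟨hw1, hw2⟩ hwB
      by_contra hne
      obtain ⟨⟨j, l⟩, hj⟩ := Function.ne_iff.1 hne
      have hl : l = h (fun i => b (j, i)) := by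
        by_contra hl
        apply hj
        apply hw2
        rintro ⟨j', hj'⟩
        simp only [Prod.mk.injEq] at hj'
        obtain ⟨rfl, h2⟩ := hj'
        exact hl h2.symm
      apply hwB j
      convert hh (fun i => b (j, i)) using 1
      ext i
      by_cases hi : i = l
      · subst hi
        rw [← hl]
        simp only [Pi.add_apply, Pi.single_eq_same]
        revert hj
        generalize w (j, i) = a
        generalize b (j, i) = b
        revert a b; decide
      · rw [← hl]
        simp only [Pi.add_apply, Pi.single_eq_of_ne hi, add_zero]
        apply hw2
        rintro ⟨j', hj'⟩
        simp only [Prod.mk.injEq] at hj'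
        obtain ⟨rfl, h2⟩ := hj'
        exact hi (h2.symm.trans hl.symm)

lemma p21 (h0 : (0 : Q (Fin k)) ∈ X) : ∃ (ζ : Type) (_ : Fintype ζ) (H1 H2 : Set (Q ζ)),
    Til X H1 ∧ Til X H2 ∧ ∀ x, x ∈ H1 ∨ x ∈ H2 := by
  obtain ⟨ι, _, B, T, hB, hT⟩ := step2 h0
  let cc : Q (Q ι × ι) → Q ι := fun x => ∑ m, fun i => x (m, i)
  let TT : Q (Q ι × ι) → Set (Q (Q ι × ι)) := fun x => {w | (∀ m, m ≠ cc x → ∀ i, w (m, i) = x (m, i)) ∧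
    (fun i => w (cc x, i)) ∈ T (fun i => x (cc x, i))}
  refine ⟨Q ι × ι, inferInstance, {x | ∃ m, (fun i => x (m, i)) ∈ Bᶜ},
    ⋃ x : {x : Q (Q ι × ι) // ∀ m, (fun i => x (m, i)) ∈ B}, TT x, til_pow _ (fun _ => hB), ?_, ?_⟩
  · apply til_iUnion
    · rintro ⟨x, hx⟩
      have hinj : Injective (fun i : ι => (cc x, i)) := fun a b h => by simpa using h
      apply til_slice hinj
      intro z
      convert til_ite (X := X) (R := T (fun i => x (cc x, i))) (∀ m, m ≠ cc x → ∀ i, z (m, i) = x (m, i))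
        (fun _ => (hT _ (hx _)).1.til) using 1
      ext u
      simp only [Set.mem_ofPred_eq, TT]
      have e1 : (fun i => extend (fun i : ι => (cc x, i)) u z (cc x, i)) = u := by
        ext i
        exact hinj.extend_apply u z i
      rw [e1]
      refine and_congr_left fun _ => forall_congr' fun m' => forall_congr' fun hm' => 
        forall_congr' fun i => ?_
      rw [extend_apply' _ _ _ (by rintro ⟨a, ha⟩; simp at ha; exact hm' ha.1.symm)]
    · rintro ⟨x, hx⟩ ⟨x', hx'⟩ y ⟨h1, h2⟩ ⟨h1', h2'⟩
      simp only [Subtype.mk.injEq]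
      dsimp only at h1 h2 h1' h2'
      by_cases hc : cc x = cc x'
      · have hoff : ∀ m, m ≠ cc x → (fun i => x (m, i)) = fun i => x' (m, i) := by
          intro m hm
          ext i
          rw [← h1 m hm i, h1' m (hc ▸ hm) i]
        have hon : (fun i => x (cc x, i)) = fun i => x' (cc x, i) := by
          have e1 := Finset.add_sum_erase Finset.univ (fun m => (fun i => x (m, i))) (Finset.mem_univ (cc x))
          have e2 := Finset.add_sum_erase Finset.univ (fun m => (fun i => x' (m, i))) (Finset.mem_univ (cc x))
          have e3 : ∑ m ∈ Finset.univ.erase (cc x), (fun i => x (m, i)) =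
              ∑ m ∈ Finset.univ.erase (cc x), (fun i => x' (m, i)) :=
            Finset.sum_congr rfl fun m hm => hoff m (Finset.ne_of_mem_erase hm)
          have e4 : ∑ m, (fun i => x (m, i)) = ∑ m, (fun i => x' (m, i)) := hc
          rw [← e1, ← e2, e3] at e4
          exact add_right_cancel e4
        ext ⟨m, i⟩
        by_cases hm : m = cc x
        · rw [hm]; exact congrFun hon i
        · exact congrFun (hoff m hm) i
      · have g1 := (hT _ (hx (cc x))).2.2 _ h2 (by
          convert hx' (cc x) using 1
          ext i; exact h1' _ hc i)
        have g2 := (hT _ (hx' (cc x'))).2.2 _ h2' (by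
          convert hx (cc x') using 1
          ext i; exact h1 _ (Ne.symm hc) i)
        ext ⟨m, i⟩
        trans y (m, i)
        · by_cases hm : m = cc x
          · rw [hm]; exact (congrFun g1 i).symm
          · exact (h1 m hm i).symm
        · by_cases hm : m = cc x'
          · rw [hm]; exact (congrFun g2 i)
          · exact (h1' m hm i)
  · intro x
    by_cases hx : ∀ m, (fun i => x (m, i)) ∈ B
    · right
      refine Set.mem_iUnion.2 ⟨⟨x, hx⟩, fun _ _ _ => rfl, (hT _ (hx _)).2.1⟩
    · left
      simpa using hx
end HC

namespace HC
open Function Classical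
variable {k : ℕ} {X : Finset (Q (Fin k))} {ι κ : Type}

/-- integer span of the indicators of tiles -/
noncomputable def sp (X : Finset (Q (Fin k))) (ι : Type) : AddSubgroup (Q ι → ℤ) :=
  AddSubgroup.closure {f | ∃ T, IsTile X T ∧ f = fun z => if z ∈ T then 1 else 0}

lemma sp_tile {T : Set (Q ι)} (h : IsTile X T) : (fun z => if z ∈ T then (1 : ℤ) else 0) ∈ sp X ι :=
  AddSubgroup.subset_closure ⟨T, h, rfl⟩

lemma sp_translate (v : Q ι) {f : Q ι → ℤ} (hf : f ∈ sp X ι) : (fun x => f (x + v)) ∈ sp X ι := by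
  induction hf using AddSubgroup.closure_induction with
  | mem f hf =>
    obtain ⟨T, hT, rfl⟩ := hf
    exact sp_tile (hT.translate v)
  | zero => exact (sp X ι).zero_mem
  | add a b _ _ ha hb => exact (sp X ι).add_mem ha hb
  | neg a _ ha => exact (sp X ι).neg_mem ha

lemma sp_right [Fintype ι] (g : Q ι → ℤ) {f : Q κ → ℤ} (hf : f ∈ sp X κ) :
    (fun z : Q (ι ⊕ κ) => g (z ∘ Sum.inl) * f (z ∘ Sum.inr)) ∈ sp X (ι ⊕ κ) := by
  induction hf using AddSubgroup.closure_induction with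
  | mem f hf =>
    obtain ⟨T, hT, rfl⟩ := hf
    have : ∀ u : Q ι, IsTile X {z : Q (ι ⊕ κ) | z ∘ Sum.inl = u ∧ z ∘ Sum.inr ∈ T} := by
      intro u
      obtain ⟨e, he, z, c, rfl⟩ := hT
      refine ⟨Sum.inr ∘ e, Sum.inr_injective.comp he, Sum.elim u z, c, ?_⟩
      ext w
      simp only [Set.mem_ofPred_eq]
      constructor
      · rintro ⟨h1, h2, h3⟩
        refine ⟨h2, ?_⟩
        rintro (i | i) hi
        · exact congrFun h1 i
        · exact h3 i (by rintro ⟨a, rfl⟩; exact hi ⟨a, rfl⟩)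
      · rintro ⟨h1, h2⟩
        refine ⟨?_, h1, ?_⟩
        · ext i; exact h2 (Sum.inl i) (by simp)
        · intro i hi; exact h2 (Sum.inr i) (by rintro ⟨a, ha⟩; exact hi ⟨a, Sum.inr_injective ha⟩)
    convert (sp X (ι ⊕ κ)).sum_mem (t := Finset.univ)
      (fun u _ => (sp X (ι ⊕ κ)).zsmul_mem (sp_tile (this u)) (g u)) using 1
    ext z
    rw [Finset.sum_apply, Finset.sum_eq_single (z ∘ Sum.inl)]
    · simp
    · intro u _ hu
      simp [hu.symm]
    · simp
  | zero => convert (sp X (ι ⊕ κ)).zero_mem using 1; ext z; simp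
  | add a b _ _ ha hb => convert (sp X (ι ⊕ κ)).add_mem ha hb using 1; ext z; simp [mul_add]
  | neg a _ ha => convert (sp X (ι ⊕ κ)).neg_mem ha using 1; ext z; simp

lemma sp_left [Fintype κ] (g : Q κ → ℤ) {f : Q ι → ℤ} (hf : f ∈ sp X ι) :
    (fun z : Q (ι ⊕ κ) => f (z ∘ Sum.inl) * g (z ∘ Sum.inr)) ∈ sp X (ι ⊕ κ) := by
  induction hf using AddSubgroup.closure_induction with
  | mem f hf =>
    obtain ⟨T, hT, rfl⟩ := hf
    have : ∀ u : Q κ, IsTile X {z : Q (ι ⊕ κ) | z ∘ Sum.inr = u ∧ z ∘ Sum.inl ∈ T} := by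
      intro u
      obtain ⟨e, he, z, c, rfl⟩ := hT
      refine ⟨Sum.inl ∘ e, Sum.inl_injective.comp he, Sum.elim z u, c, ?_⟩
      ext w
      simp only [Set.mem_ofPred_eq]
      constructor
      · rintro ⟨h1, h2, h3⟩
        refine ⟨h2, ?_⟩
        rintro (i | i) hi
        · exact h3 i (by rintro ⟨a, rfl⟩; exact hi ⟨a, rfl⟩)
        · exact congrFun h1 i
      · rintro ⟨h1, h2⟩
        refine ⟨?_, h1, ?_⟩
        · ext i; exact h2 (Sum.inr i) (by simp)
        · intro i hi; exact h2 (Sum.inl i) (by rintro ⟨a, ha⟩; exact hi ⟨a, Sum.inl_injective ha⟩)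
    convert (sp X (ι ⊕ κ)).sum_mem (t := Finset.univ)
      (fun u _ => (sp X (ι ⊕ κ)).zsmul_mem (sp_tile (this u)) (g u)) using 1
    ext z
    rw [Finset.sum_apply, Finset.sum_eq_single (z ∘ Sum.inr)]
    · simp
    · intro u _ hu
      simp [hu.symm]
    · simp
  | zero => convert (sp X (ι ⊕ κ)).zero_mem using 1; ext z; simp
  | add a b _ _ ha hb => convert (sp X (ι ⊕ κ)).add_mem ha hb using 1; ext z; simp [add_mul]
  | neg a _ ha => convert (sp X (ι ⊕ κ)).neg_mem ha using 1; ext z; simp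

lemma isTile_translate (v : Q (Fin k)) : IsTile X {x : Q (Fin k) | x + v ∈ X} :=
  ⟨id, injective_id, 0, v, by ext w; simp⟩

lemma odd1 (h0 : (0 : Q (Fin k)) ∈ X) (s : Finset (Fin k)) : ∃ f ∈ sp X (Fin k),
    (∃ x, (f x : ZMod 2) ≠ 0) ∧
    ∀ i ∈ s, ∀ x, (f (x + (Pi.single i 1 : Q (Fin k))) : ZMod 2) = f x := by
  induction s using Finset.induction_on with
  | empty =>
    refine ⟨_, sp_tile (isTile_translate 0), ⟨0, ?_⟩, by simp⟩
    simp [h0]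
  | insert i s hi ih =>
    obtain ⟨f, hf, ⟨x, hx⟩, hs⟩ := ih
    by_cases hinv : ∀ x, (f (x + (Pi.single i 1 : Q (Fin k))) : ZMod 2) = f x
    · refine ⟨f, hf, ⟨x, hx⟩, fun j hj => ?_⟩
      rcases Finset.mem_insert.1 hj with rfl | hj
      · exact hinv
      · exact hs j hj
    · push Not at hinv
      obtain ⟨y, hy⟩ := hinv
      refine ⟨_, (sp X _).add_mem hf (sp_translate (Pi.single i 1 : Q (Fin k)) hf), ⟨y, ?_⟩, ?_⟩
      · simp only [Pi.add_apply, Int.cast_add]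
        intro h
        apply hy
        rw [eq_comm, ← CharTwo.add_eq_zero]; exact h
      · intro j hj x
        simp only [Pi.add_apply, Int.cast_add]
        rcases Finset.mem_insert.1 hj with rfl | hj
        · have : x + (Pi.single j 1 : Q (Fin k)) + (Pi.single j 1 : Q (Fin k)) = x := by
            ext a; simp [add_assoc, CharTwo.add_self_eq_zero]
          rw [this, add_comm]
        · rw [hs j hj, add_right_comm, hs j hj]

lemma odd2 (h0 : (0 : Q (Fin k)) ∈ X) : ∃ f ∈ sp X (Fin k), ∃ h : Q (Fin k) → ℤ, ∀ x, 1 = f x + 2 * h x := by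
  obtain ⟨f, hf, ⟨x, hx⟩, hs⟩ := odd1 h0 Finset.univ
  refine ⟨f, hf, ?_⟩
  have key : ∀ (v : Q (Fin k)) (s : Finset (Fin k)) (y : Q (Fin k)),
      (f (y + ∑ i ∈ s, (Pi.single i (v i) : Q (Fin k))) : ZMod 2) = f y := by
    intro v s
    induction s using Finset.induction_on with
    | empty => simp
    | insert i s hi ih =>
      intro y
      rw [Finset.sum_insert hi, ← add_assoc, ih]
      rcases (by generalize v i = a; revert a; decide : v i = 0 ∨ v i = 1) with h | h
      · simp [h]
      · rw [h]; exact hs i (Finset.mem_univ _) y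
  have : ∀ y, ∃ b : ℤ, 1 = f y + 2 * b := by
    intro y
    have h1 := key (y - x) Finset.univ x
    rw [Finset.univ_sum_single, add_sub_cancel] at h1
    have h2 : (f y : ZMod 2) ≠ 0 := by rw [h1]; exact hx
    have h3 : ¬ (2 : ℤ) ∣ f y := by
      intro h; exact h2 ((ZMod.intCast_zmod_eq_zero_iff_dvd _ 2).2 (by exact_mod_cast h))
    exact ⟨(1 - f y) / 2, by omega⟩
  choose h hh using this
  exact ⟨h, hh⟩

lemma sp_pow (h0 : (0 : Q (Fin k)) ∈ X) (j : ℕ) : ∃ (ι : Type) (_ : Fintype ι) (g : Q ι → ℤ),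
    (fun z => 1 - 2 ^ j * g z) ∈ sp X ι := by
  induction j with
  | zero =>
    refine ⟨Empty, inferInstance, fun _ => 1, ?_⟩
    convert (sp X Empty).zero_mem using 1
    ext z; simp
  | succ j ih =>
    obtain ⟨ι, _, g, hg⟩ := ih
    obtain ⟨f, hf, h, hh⟩ := odd2 h0
    refine ⟨ι ⊕ Fin k, inferInstance, fun z => g (z ∘ Sum.inl) * h (z ∘ Sum.inr), ?_⟩
    convert (sp X (ι ⊕ Fin k)).add_mem (sp_left (fun _ => 1) hg) (sp_right (fun z => 2 ^ j * g z) hf) using 1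
    ext z
    simp only [Pi.add_apply]
    have := hh (z ∘ Sum.inr)
    have : f (z ∘ Sum.inr) = 1 - 2 * h (z ∘ Sum.inr) := by linarith
    rw [this]
    ring

lemma sp_one (h0 : (0 : Q (Fin k)) ∈ X) {d : ℕ} (hd : X.card = 2 ^ d) :
    ∃ (ι : Type) (_ : Fintype ι), (fun _ => 1) ∈ sp X ι := by
  obtain ⟨ι, _, g, hg⟩ := sp_pow h0 d
  have h2 : (fun _ => (2 : ℤ) ^ d) ∈ sp X (Fin k) := by
    convert (sp X (Fin k)).sum_mem (t := Finset.univ) (fun u _ => sp_tile (isTile_translate (X := X) u)) using 1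
    ext z
    rw [Finset.sum_apply]
    simp only [Set.mem_ofPred_eq]
    have e := Fintype.sum_equiv (Equiv.addLeft z) (fun u => if z + u ∈ X then (1 : ℤ) else 0)
      (fun u => if u ∈ X then (1 : ℤ) else 0) (fun u => rfl)
    rw [Finset.sum_ite_mem] at e
    simp only [Finset.univ_inter, Finset.sum_const, hd] at e
    rw [eq_comm]
    convert e using 1
    · congr!
    · simp
  refine ⟨ι ⊕ Fin k, inferInstance, ?_⟩
  convert (sp X (ι ⊕ Fin k)).add_mem (sp_left (fun _ => 1) hg) (sp_right g h2) using 1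
  ext z
  simp only [Pi.add_apply]
  ring

lemma sp_repr {f : Q ι → ℤ} (hf : f ∈ sp X ι) : ∃ (T : Type) (_ : Fintype T) (P N : T → Set (Q ι)),
    (∀ t, Til X (P t)) ∧ (∀ t, Til X (N t)) ∧
    ∀ z, f z + ∑ t, (if z ∈ N t then 1 else 0) = ∑ t, if z ∈ P t then 1 else 0 := by
  induction hf using AddSubgroup.closure_induction with
  | mem f hf =>
    obtain ⟨T, hT, rfl⟩ := hf
    exact ⟨Unit, inferInstance, fun _ => T, fun _ => ∅, fun _ => hT.til, fun _ => til_empty, by simp⟩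
  | zero => exact ⟨Empty, inferInstance, fun _ => ∅, fun _ => ∅, by simp, by simp, by simp⟩
  | add a b _ _ ha hb =>
    obtain ⟨T, _, P, N, h1, h2, h3⟩ := ha
    obtain ⟨T', _, P', N', h1', h2', h3'⟩ := hb
    refine ⟨T ⊕ T', inferInstance, Sum.elim P P', Sum.elim N N', ?_, ?_, ?_⟩
    · rintro (t | t)
      exacts [h1 t, h1' t]
    · rintro (t | t)
      exacts [h2 t, h2' t]
    · intro z
      have e := congrArg₂ (· + ·) (h3 z) (h3' z)
      simp only [Fintype.sum_sum_type, Sum.elim_inl, Sum.elim_inr, Pi.add_apply]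
      convert e using 1
      · ring_nf
        congr!
      · congr!
  | neg a _ ha =>
    obtain ⟨T, _, P, N, h1, h2, h3⟩ := ha
    refine ⟨T, inferInstance, N, P, h2, h1, fun z => ?_⟩
    rw [← h3]; simp

lemma signed (h0 : (0 : Q (Fin k)) ∈ X) {d : ℕ} (hd : X.card = 2 ^ d) :
    ∃ (θ : Type) (_ : Fintype θ) (T : Type) (_ : Fintype T) (t0 : T) (P N : T → Set (Q θ)),
      (∀ t, Til X (P t)) ∧ (∀ t, t ≠ t0 → Til X (N t)) ∧ (∀ z, z ∈ N t0) ∧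
      ∀ z, ∃ σ : Equiv.Perm T, ∀ t, z ∈ N t ↔ z ∈ P (σ t) := by
  obtain ⟨θ, _, h1⟩ := sp_one h0 hd
  obtain ⟨T, _, P, N, hP, hN, h⟩ := sp_repr h1
  refine ⟨θ, inferInstance, Option T, inferInstance, none, fun t => t.elim ∅ P, fun t => t.elim Set.univ N,
    ?_, ?_, by simp, ?_⟩
  · rintro (_ | t)
    exacts [til_empty, hP t]
  · rintro (_ | t) ht
    · exact absurd rfl ht
    · exact hN t
  · intro z
    have hc : Fintype.card {t : Option T // z ∈ t.elim Set.univ N} =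
        Fintype.card {t : Option T // z ∈ t.elim ∅ P} := by
      rw [Fintype.card_subtype, Fintype.card_subtype, Finset.card_filter, Finset.card_filter,
        Fintype.sum_option, Fintype.sum_option]
      zify
      have e := h z
      simp only [Option.elim]
      convert e using 1
      · simp only [Set.mem_univ, if_true]
        congr!
      · simp only [Set.mem_empty_iff_false, if_false, zero_add]
        congr!
    obtain ⟨e⟩ := Fintype.card_eq.1 hc
    refine ⟨e.extendSubtype, fun t => ⟨fun ht => e.extendSubtype_mem t ht, fun ht => ?_⟩⟩
    by_contra hn
    exact e.extendSubtype_not_mem t hn ht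
end HC

namespace HC
open Function Classical
variable {k : ℕ} {X : Finset (Q (Fin k))} {ι κ : Type}

inductive Node (T : Type) : Type
  | n (t : T) : Node T
  | v (s : T) : Node T
  | x (t s : T) : Node T
  | y (t s : T) : Node T

noncomputable def sg {D : Type} (d : D) : Q D := fun e => if e = d then 1 else 0

noncomputable def emb0 {T : Type} : Node T → Q (T ⊕ T ⊕ Unit)
  | Node.n t => sg (Sum.inl t)
  | Node.v s => sg (Sum.inr (Sum.inl s)) + sg (Sum.inr (Sum.inr ()))
  | Node.x t s => sg (Sum.inl t) + sg (Sum.inr (Sum.inl s))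
  | Node.y t s => sg (Sum.inl t) + sg (Sum.inr (Sum.inl s)) + sg (Sum.inr (Sum.inr ()))

lemma emb0_inj {T : Type} : Injective (emb0 (T := T)) := by
  intro a b h
  have h1 : ∀ t, emb0 a (Sum.inl t) = emb0 b (Sum.inl t) := fun t => by rw [h]
  have h2 : ∀ t, emb0 a (Sum.inr (Sum.inl t)) = emb0 b (Sum.inr (Sum.inl t)) := fun t => by rw [h]
  have h3 : emb0 a (Sum.inr (Sum.inr ())) = emb0 b (Sum.inr (Sum.inr ())) := by rw [h]
  cases a with
  | n t =>
    have g1 := h1 t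
    cases b with
    | n t' => simp [emb0, sg] at g1; simpa using g1
    | v s' => simp [emb0, sg] at g1
    | x t' s' => have g2 := h2 s'; simp [emb0, sg] at g2
    | y t' s' => simp [emb0, sg] at h3
  | v s =>
    have g2 := h2 s
    cases b with
    | n t' => simp [emb0, sg] at g2
    | v s' => simp [emb0, sg] at g2; simpa using g2
    | x t' s' => simp [emb0, sg] at h3
    | y t' s' => have g1 := h1 t'; simp [emb0, sg] at g1
  | x t s =>
    have g1 := h1 t
    have g2 := h2 s
    cases b with
    | n t' => simp [emb0, sg] at g2
    | v s' => simp [emb0, sg] at g1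
    | x t' s' => simp [emb0, sg] at g1 g2; simp [g1, g2]
    | y t' s' => simp [emb0, sg] at h3
  | y t s =>
    have g1 := h1 t
    have g2 := h2 s
    cases b with
    | n t' => simp [emb0, sg] at g2
    | v s' => simp [emb0, sg] at g1
    | x t' s' => simp [emb0, sg] at h3
    | y t' s' => simp [emb0, sg] at g1 g2; simp [g1, g2]

noncomputable def emb {T : Type} (t0 : T) (n : Node T) : Q (T ⊕ T ⊕ Unit) := emb0 n + sg (Sum.inl t0)

lemma emb_inj {T : Type} (t0 : T) : Injective (emb t0) := fun _ _ h => emb0_inj (add_right_cancel h)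

noncomputable def vert {D : Type} (l : Q (D × Fin k)) : Q D :=
  fun δ => if (fun i => l (δ, i)) = 0 then 0 else 1

lemma two_self {D : Type} (a : Q D) : a + a = 0 := by
  ext i; exact CharTwo.add_self_eq_zero _

lemma emb_t0 {T : Type} (t0 : T) : emb t0 (Node.n t0) = 0 := two_self _

lemma vert_eq_zero {D : Type} {l : Q (D × Fin k)} : vert l = 0 ↔ l = 0 := by
  constructor
  · intro h
    ext ⟨δ, i⟩
    have := congrFun h δ
    simp only [vert, Pi.zero_apply, ite_eq_left_iff, one_ne_zero, imp_false, not_not] at this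
    exact congrFun this i
  · rintro rfl
    ext δ
    simp only [vert, Pi.zero_apply, ite_eq_left_iff, one_ne_zero, imp_false, not_not]
    rfl

lemma gad2 {D Nd : Type} (em : Nd → Q D) (hem : Injective em) (K : Nd → Prop) (nb : Nd → Nd)
    (dir : Nd → D) (h1 : ∀ n, K n → K (nb n)) (h2 : ∀ n, K n → dir (nb n) = dir n)
    (h3 : ∀ n, K n → em (nb n) = em n + sg (dir n)) :
    Til X {l : Q (D × Fin k) | (∀ δ, (fun i => l (δ, i)) ∈ X) ∧ ∃ n, K n ∧ em n = vert l} := by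
  let S : D → Q (D × Fin k) → Set (Q (D × Fin k)) := fun δ l =>
    {w | w ∘ (fun i => (δ, i)) + 0 ∈ X ∧ ∀ i, i ∉ Set.range (fun i : Fin k => (δ, i)) → w i = l i}
  let f : Q (D × Fin k) → Set (Q (D × Fin k)) := fun l =>
    if h : ∃ n, K n ∧ em n = vert l then S (dir h.choose) l else ∅
  have hf : ∀ l n, K n → em n = vert l → f l = S (dir n) l := by
    intro l n hn hl
    have h : ∃ n, K n ∧ em n = vert l := ⟨n, hn, hl⟩
    simp only [f, dif_pos h]
    rw [hem (h.choose_spec.2.trans hl.symm)]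
  refine ⟨f, ?_⟩
  rintro l ⟨hl, n, hn, hnl⟩
  rw [hf l n hn hnl]
  have hw : ∀ w ∈ S (dir n) l, (∀ δ, (fun i => w (δ, i)) ∈ X) ∧
      ∃ n', K n' ∧ em n' = vert w ∧ dir n' = dir n := by
    rintro w ⟨w1, w2⟩
    have hoff : ∀ δ, δ ≠ dir n → (fun i => w (δ, i)) = fun i => l (δ, i) := by
      intro δ hδ
      ext i
      apply w2
      rintro ⟨j, hj⟩
      exact hδ (congrArg Prod.fst hj).symm
    constructor
    · intro δ
      by_cases hδ : δ = dir n
      · rw [hδ]; rw [add_zero] at w1; exact w1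
      · rw [hoff δ hδ]; exact hl δ
    · by_cases hv : vert w (dir n) = vert l (dir n)
      · refine ⟨n, hn, ?_, rfl⟩
        rw [hnl]
        ext δ
        by_cases hδ : δ = dir n
        · rw [hδ, hv]
        · simp only [vert, hoff δ hδ]
      · refine ⟨nb n, h1 n hn, ?_, h2 n hn⟩
        rw [h3 n hn, hnl]
        ext δ
        by_cases hδ : δ = dir n
        · rw [hδ]
          simp only [Pi.add_apply, sg, if_true]
          revert hv
          generalize vert w (dir n) = a
          generalize vert l (dir n) = b
          revert a b; decide
        · simp only [Pi.add_apply, vert, hoff δ hδ, sg, if_neg hδ, add_zero]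
  refine ⟨⟨_, fun a b h => by simpa using h, _, _, rfl⟩, ⟨by rw [add_zero]; exact hl (dir n), fun _ _ => rfl⟩, ?_, ?_⟩
  · intro w hw'
    obtain ⟨a, n', b, c, -⟩ := hw w hw'
    exact ⟨a, n', b, c⟩
  · intro w hw'
    obtain ⟨a, n', b, c, d⟩ := hw w hw'
    rw [hf w n' b c, d]
    ext u
    simp only [S, Set.mem_ofPred_eq]
    refine and_congr_right fun _ => forall_congr' fun i => forall_congr' fun hi => ?_
    rw [hw'.2 i hi]

def keep {T : Type} (A B : T → Prop) : Node T → Prop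
  | Node.n t => A t
  | Node.v s => B s
  | Node.x _ _ => True
  | Node.y _ _ => True

lemma gad3 {T : Type} (t0 : T) (A B : T → Prop) (σ : Equiv.Perm T) (hσ : ∀ t, A t ↔ B (σ t)) :
    Til X {l : Q ((T ⊕ T ⊕ Unit) × Fin k) | (∀ δ, (fun i => l (δ, i)) ∈ X) ∧
      ∃ n, keep A B n ∧ emb t0 n = vert l} := by
  let nb : Node T → Node T := fun n => match n with
    | Node.n t => Node.x t (σ t)
    | Node.v s => Node.y (σ.symm s) s
    | Node.x t s => if s = σ t ∧ A t then Node.n t else Node.y t s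
    | Node.y t s => if s = σ t ∧ A t then Node.v s else Node.x t s
  let dir : Node T → T ⊕ T ⊕ Unit := fun n => match n with
    | Node.n t => Sum.inr (Sum.inl (σ t))
    | Node.v s => Sum.inl (σ.symm s)
    | Node.x t s => if s = σ t ∧ A t then Sum.inr (Sum.inl s) else Sum.inr (Sum.inr ())
    | Node.y t s => if s = σ t ∧ A t then Sum.inl t else Sum.inr (Sum.inr ())
  have hB : ∀ s, B s → A (σ.symm s) := fun s hs => by rw [hσ]; simpa using hs
  apply gad2 (emb t0) (emb_inj t0) (keep A B) nb dir
  · rintro (t | s | ⟨t, s⟩ | ⟨t, s⟩) h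
    · trivial
    · trivial
    · by_cases hc : s = σ t ∧ A t
      · simp only [nb, if_pos hc]; exact hc.2
      · simp only [nb, if_neg hc]; trivial
    · by_cases hc : s = σ t ∧ A t
      · simp only [nb, if_pos hc]
        show B s
        rw [hc.1, ← hσ]; exact hc.2
      · simp only [nb, if_neg hc]; trivial
  · rintro (t | s | ⟨t, s⟩ | ⟨t, s⟩) h
    · have : A t := h
      simp [nb, dir, this]
    · have := hB s h
      simp [nb, dir, this]
    · by_cases hc : s = σ t ∧ A t
      · simp [nb, dir, hc]
      · simp only [nb, dir, if_neg hc]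
    · by_cases hc : s = σ t ∧ A t
      · simp [nb, dir, hc]
      · simp only [nb, dir, if_neg hc]
  · have two : ∀ a b : Q (T ⊕ T ⊕ Unit), a = a + b + b := fun a b => by
      rw [add_assoc, two_self, add_zero]
    have aux : ∀ n n' δ, emb0 (T := T) n = emb0 n' + sg δ → emb t0 n = emb t0 n' + sg δ := by
      intro n n' δ h
      simp only [emb, h]; rw [add_right_comm]
    rintro (t | s | ⟨t, s⟩ | ⟨t, s⟩) h
    · apply aux; rfl
    · apply aux; simp only [emb0, nb, dir]; abel
    · apply aux
      by_cases hc : s = σ t ∧ A t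
      · simp only [nb, dir, if_pos hc, emb0]; exact two _ _
      · simp only [nb, dir, if_neg hc, emb0]
    · apply aux
      by_cases hc : s = σ t ∧ A t
      · simp only [nb, dir, if_pos hc, emb0]
        rw [add_assoc (sg (Sum.inl t)), add_comm (sg (Sum.inl t))]; exact two _ _
      · simp only [nb, dir, if_neg hc, emb0]; exact two _ _

lemma yspace {ζ : Type} {H1 H2 : Set (Q ζ)} (h1 : Til X H1) (h2 : Til X H2)
    (hc : ∀ x, x ∈ H1 ∨ x ∈ H2) (τ : Type) : ∃ W : Set (Q ((τ × ζ) ⊕ τ)), Til X Wᶜ ∧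
      ∀ x μ μ', Sum.elim x μ ∈ W → Sum.elim x μ' ∈ W → μ = μ' := by
  let Hs : ZMod 2 → Set (Q ζ) := fun a => if a = 0 then H1 else H2
  have hHs : ∀ a, Til X (Hs a) := by
    intro a
    by_cases ha : a = 0
    · simpa [Hs, ha] using h1
    · simpa [Hs, ha] using h2
  refine ⟨{y | ∀ i, (fun j => y (Sum.inl (i, j))) ∉ Hs (y (Sum.inr i))}, ?_, ?_⟩
  · apply til_sliceL
    intro μ
    convert til_pow (fun i => Hs (μ i)) (fun i => hHs _) using 1
    ext x
    simp
  · intro x μ μ' hμ hμ'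
    ext i
    have a1 := hμ i
    have a2 := hμ' i
    simp only [Sum.elim_inl, Sum.elim_inr] at a1 a2
    by_contra hne
    have key : ∀ a b : ZMod 2, a ≠ b → (a = 0 ∧ b = 1) ∨ (a = 1 ∧ b = 0) := by decide
    rcases key _ _ hne with ⟨e1, e2⟩ | ⟨e1, e2⟩ <;> rw [e1] at a1 <;> rw [e2] at a2 <;>
      simp [Hs] at a1 a2 <;> rcases hc (fun j => x (i, j)) with h | h
    · exact a1 h
    · exact a2 h
    · exact a2 h
    · exact a1 h

/-- the point of the space is at the given node of the gadget -/
def atN {T : Type} (X : Finset (Q (Fin k))) (t0 : T) (W : Set (Q (κ ⊕ ((T ⊕ T ⊕ Unit) × Fin k))))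
    (y : Q (κ ⊕ ((T ⊕ T ⊕ Unit) × Fin k))) (n : Node T) : Prop :=
  ∃ μ, Sum.elim (y ∘ Sum.inl) μ ∈ W ∧ (∀ δ, (fun i => (y ∘ Sum.inr + μ) (δ, i)) ∈ X) ∧
    emb t0 n = vert (y ∘ Sum.inr + μ)

section
variable {T : Type} {t0 : T} {W : Set (Q (κ ⊕ ((T ⊕ T ⊕ Unit) × Fin k)))}

lemma atN_unique (hW : ∀ x μ μ', Sum.elim x μ ∈ W → Sum.elim x μ' ∈ W → μ = μ')
    {y n n'} (h : atN X t0 W y n) (h' : atN X t0 W y n') : n = n' := by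
  obtain ⟨μ, a, -, b⟩ := h
  obtain ⟨μ', a', -, b'⟩ := h'
  obtain rfl := hW _ _ _ a a'
  exact emb_inj t0 (b.trans b'.symm)

lemma atN_t0 (h0 : (0 : Q (Fin k)) ∈ X) {y} : atN X t0 W y (Node.n t0) ↔ y ∈ W := by
  constructor
  · rintro ⟨μ, a, -, b⟩
    rw [emb_t0, eq_comm, vert_eq_zero] at b
    have : y ∘ Sum.inr = μ := by
      rw [← add_zero (y ∘ Sum.inr), ← two_self μ, ← add_assoc, b, zero_add]
    rw [← this, Sum.elim_comp_inl_inr] at a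
    exact a
  · intro h
    refine ⟨y ∘ Sum.inr, by rwa [Sum.elim_comp_inl_inr], ?_, ?_⟩
    · intro δ
      rw [two_self]; exact h0
    · rw [two_self, emb_t0, eq_comm, vert_eq_zero]

lemma til_atN (hW : ∀ x μ μ', Sum.elim x μ ∈ W → Sum.elim x μ' ∈ W → μ = μ')
    (A B : T → Prop) (σ : Equiv.Perm T) (hσ : ∀ t, A t ↔ B (σ t)) :
    Til X {y | ∃ n, atN X t0 W y n ∧ keep A B n} := by
  apply til_sliceR
  intro x
  by_cases hx : ∃ μ, Sum.elim x μ ∈ W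
  · obtain ⟨μ, hμ⟩ := hx
    convert (gad3 (X := X) t0 A B σ hσ).translate μ using 1
    ext y
    simp only [Set.mem_ofPred_eq, atN, Sum.elim_comp_inl, Sum.elim_comp_inr]
    constructor
    · rintro ⟨n, ⟨μ', a, b, c⟩, d⟩
      obtain rfl := hW _ _ _ a hμ
      exact ⟨b, n, d, c⟩
    · rintro ⟨b, n, d, c⟩
      exact ⟨n, ⟨μ, hμ, b, c⟩, d⟩
  · convert til_empty using 1
    ext y
    simp only [Set.mem_ofPred_eq, Set.mem_empty_iff_false, iff_false]
    rintro ⟨n, ⟨μ, a, -⟩, -⟩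
    exact hx ⟨μ, a⟩
end

lemma core (h0 : (0 : Q (Fin k)) ∈ X) {d : ℕ} (hd : X.card = 2 ^ d) :
    ∃ (ι : Type) (_ : Fintype ι), Til X (Set.univ : Set (Q ι)) := by
  obtain ⟨ζ, _, H1, H2, hH1, hH2, hc⟩ := p21 h0
  obtain ⟨θ, _, T, _, t0, P, N, hP, hN, hN0, hσ⟩ := signed h0 hd
  obtain ⟨W, hWt, hW⟩ := yspace hH1 hH2 hc ((T ⊕ T ⊕ Unit) × Fin k)
  let Free : Q (_ ⊕ (ζ ⊕ θ)) → Prop := fun p =>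
    if p ∘ Sum.inr ∘ Sum.inl ∈ H1 then
      ∃ n, atN X t0 W (p ∘ Sum.inl) n ∧
        (p ∘ Sum.inr ∘ Sum.inl ∈ H2 → keep (fun t => p ∘ Sum.inr ∘ Sum.inr ∉ N t)
          (fun s => p ∘ Sum.inr ∘ Sum.inr ∉ P s) n)
    else p ∘ Sum.inl ∉ W
  refine ⟨_, inferInstance, til_cls Free ?_⟩
  intro b
  by_cases hb : b
  · apply til_sliceL
    intro q
    have hs : ∀ y : Q ((((T ⊕ T ⊕ Unit) × Fin k) × ζ) ⊕ ((T ⊕ T ⊕ Unit) × Fin k)),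
        Sum.elim y q ∘ Sum.inr ∘ Sum.inl = q ∘ Sum.inl ∧
        Sum.elim y q ∘ Sum.inr ∘ Sum.inr = q ∘ Sum.inr ∧ Sum.elim y q ∘ Sum.inl = y :=
      fun y => ⟨rfl, rfl, rfl⟩
    simp only [Set.mem_univ, true_and, hb, eq_iff_iff, iff_true, Free, Set.mem_ofPred_eq,
      (hs _).1, (hs _).2.1, (hs _).2.2]
    by_cases hz1 : q ∘ Sum.inl ∈ H1
    · simp only [hz1, if_true]
      by_cases hz2 : q ∘ Sum.inl ∈ H2
      · simp only [hz2, true_imp_iff]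
        obtain ⟨σ, hσ⟩ := hσ (q ∘ Sum.inr)
        exact til_atN hW _ _ σ (fun t => not_congr (hσ t))
      · simp only [hz2, false_imp_iff]
        convert til_atN (X := X) (t0 := t0) hW (fun _ => True) (fun _ => True) 1 (fun t => Iff.rfl) using 5 with y n
        cases n <;> simp [keep]
    · simp only [hz1, if_false]
      exact hWt
  · apply til_sliceR
    intro y
    have hs : ∀ q : Q (ζ ⊕ θ),
        Sum.elim y q ∘ Sum.inr ∘ Sum.inl = q ∘ Sum.inl ∧
        Sum.elim y q ∘ Sum.inr ∘ Sum.inr = q ∘ Sum.inr ∧ Sum.elim y q ∘ Sum.inl = y :=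
      fun q => ⟨rfl, rfl, rfl⟩
    simp only [Set.mem_univ, true_and, hb, eq_iff_iff, iff_false, Free, Set.mem_ofPred_eq,
      (hs _).1, (hs _).2.1, (hs _).2.2]
    by_cases hn : ∃ n, atN X t0 W y n
    · obtain ⟨n, hn⟩ := hn
      have hex : ∀ p : Node T → Prop, (∃ n, atN X t0 W y n ∧ p n) ↔ p n := by
        intro p
        constructor
        · rintro ⟨n', h1, h2⟩
          rwa [atN_unique hW hn h1]
        · exact fun h => ⟨n, hn, h⟩
      simp only [hex]
      by_cases hnt : n = Node.n t0
      · subst hnt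
        have hyW := (atN_t0 h0).1 hn
        apply til_sliceL
        intro w
        convert hH2 using 1
        ext z
        simp only [Set.mem_ofPred_eq, Sum.elim_comp_inl, Sum.elim_comp_inr, keep, hN0, hyW]
        have := hc z
        by_cases hz : z ∈ H1 <;> simp_all
      · have hyW : y ∉ W := fun h => hnt (atN_unique hW hn ((atN_t0 h0).2 h))
        apply til_sliceR
        intro z
        simp only [Set.mem_ofPred_eq, Sum.elim_comp_inl, Sum.elim_comp_inr, hyW, not_false_eq_true]
        by_cases hz : z ∈ H1 ∧ z ∈ H2
        · simp only [hz, if_true, true_imp_iff]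
          cases n with
          | n t =>
            have ht : t ≠ t0 := fun h => hnt (by rw [h])
            simpa [keep] using hN t ht
          | v s => simpa [keep] using hP s
          | x t s => simpa [keep] using til_empty
          | y t s => simpa [keep] using til_empty
        · convert til_empty using 1
          ext w
          simp only [Set.mem_ofPred_eq, Set.mem_empty_iff_false, iff_false, not_not]
          by_cases hz1 : z ∈ H1
          · simp only [hz1, if_true]
            intro h; exact absurd ⟨hz1, h⟩ hz
          · simp only [hz1, if_false]
    · have hyW : y ∉ W := fun h => hn ⟨_, (atN_t0 h0).2 h⟩
      apply til_sliceL
      intro w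
      convert hH1 using 1
      ext z
      simp only [Set.mem_ofPred_eq, Sum.elim_comp_inl, Sum.elim_comp_inr, hyW, not_false_eq_true]
      by_cases hz : z ∈ H1
      · simp only [hz, if_true, iff_true]
        rintro ⟨n, h, -⟩
        exact hn ⟨n, h⟩
      · simp [hz]
end HC

namespace HC
open Function Classical
variable {k : ℕ} {X : Finset (Q (Fin k))} {ι κ : Type}

lemma to_fin [Fintype ι] (h : Til X (Set.univ : Set (Q ι))) :
    ∃ n : ℕ, 0 < n ∧ Til X (Set.univ : Set (Q (Fin n))) := by
  refine ⟨Fintype.card ι + 1, Nat.succ_pos _, ?_⟩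
  apply til_slice (g := Fin.castSucc ∘ Fintype.equivFin ι)
    ((Fin.castSucc_injective _).comp (Equiv.injective _))
  intro z
  simpa using h

lemma ham {n : ℕ} {g : Fin k → Fin n} (hg : Injective g) (u v : Q (Fin k)) (z : Q (Fin n)) :
    hammingDist (extend g u z) (extend g v z) = hammingDist u v := by
  unfold hammingDist
  rw [← Finset.card_map ⟨g, hg⟩]
  congr 1
  ext j
  simp only [Finset.mem_filter, Finset.mem_univ, true_and, Finset.mem_map, Function.Embedding.coeFn_mk]
  constructor
  · intro h
    by_cases hj : ∃ i, g i = j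
    · obtain ⟨i, rfl⟩ := hj
      rw [hg.extend_apply, hg.extend_apply] at h
      exact ⟨i, h, rfl⟩
    · rw [extend_apply' _ _ _ hj, extend_apply' _ _ _ hj] at h
      exact absurd rfl h
  · rintro ⟨i, h, rfl⟩
    rwa [hg.extend_apply, hg.extend_apply]

lemma tile_iso {n : ℕ} (a0 : Q (Fin k)) {T : Set (Q (Fin n))} (h : IsTile (X.image (· + a0)) T) :
    ∃ φ : Q (Fin k) → Q (Fin n), (∀ a b, hammingDist (φ a) (φ b) = hammingDist a b) ∧ φ '' ↑X = T := by
  obtain ⟨g, hg, z, c, rfl⟩ := h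
  refine ⟨fun a => extend g (a + (a0 + c)) z, fun a b => ?_, ?_⟩
  · rw [ham hg]
    unfold hammingDist
    congr 1
    ext i
    simp
  · ext w
    simp only [Set.mem_image, Finset.mem_coe, Set.mem_ofPred_eq, Finset.mem_image]
    constructor
    · rintro ⟨a, ha, rfl⟩
      refine ⟨⟨a, ha, ?_⟩, fun i hi => extend_apply' _ _ _ (by simpa using hi)⟩
      have e : extend g (a + (a0 + c)) z ∘ g = a + (a0 + c) := by
        ext i; exact hg.extend_apply _ _ i
      rw [e, ← add_assoc, add_assoc _ c c, two_self, add_zero]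
    · rintro ⟨⟨a, ha, h1⟩, h2⟩
      refine ⟨a, ha, ?_⟩
      rw [← add_assoc, h1, add_assoc, two_self, add_zero]
      ext j
      by_cases hj : ∃ i, g i = j
      · obtain ⟨i, rfl⟩ := hj
        rw [hg.extend_apply]; rfl
      · rw [extend_apply' _ _ _ hj, h2 j (by simpa using hj)]

end HC

theorem stmt_4 (k : ℕ) (X : Finset (Fin k → ZMod 2)) (d : ℕ) (hX : X.card = 2 ^ d) :
    ∃ n : ℕ, 0 < n ∧ ∃ P : Set (Set (Fin n → ZMod 2)),
      (∀ A ∈ P, ∃ φ : (Fin k → ZMod 2) → (Fin n → ZMod 2),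
        (∀ a b, hammingDist (φ a) (φ b) = hammingDist a b) ∧ φ '' ↑X = A) ∧
      (∀ x : Fin n → ZMod 2, ∃! A, A ∈ P ∧ x ∈ A) := by
  classical
  have hne : X.Nonempty := by
    rw [← Finset.card_pos, hX]; positivity
  obtain ⟨a0, ha0⟩ := hne
  have h0 : (0 : HC.Q (Fin k)) ∈ X.image (· + a0) :=
    Finset.mem_image.2 ⟨a0, ha0, HC.two_self a0⟩
  have hd : (X.image (· + a0)).card = 2 ^ d := by
    rw [Finset.card_image_of_injective _ (add_left_injective a0), hX]
  obtain ⟨ι, _, hι⟩ := HC.core h0 hd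
  obtain ⟨n, hn, f, hf⟩ := HC.to_fin hι
  refine ⟨n, hn, Set.range f, ?_, ?_⟩
  · rintro _ ⟨x, rfl⟩
    apply HC.tile_iso a0
    convert (hf x (Set.mem_univ _)).1
  · intro x
    refine ⟨f x, ⟨⟨x, rfl⟩, (hf x (Set.mem_univ _)).2.1⟩, ?_⟩
    rintro _ ⟨⟨y, rfl⟩, hy⟩
    exact ((hf y (Set.mem_univ _)).2.2.2 x hy).symm
end

section
/- If for some positive integer m the family of isometric copies of X ⊆ {0,1}^k in {0,1}^m contains both an r-partition and a mod-r partition of {0,1}^m (for some positive integer r), and if every copy (in the product sense) of an isometric copy of X is itself an isometric copy of X, then there exists n such that {0,1}^n can be partitioned into isometric copies of X. More concretely: a copy, in {0,1}^{mn} = ({0,1}^m)^n, of a subset Y ⊆ {0,1}^m — i.e., a set of the form π(Y × {z}) for z ∈ ({0,1}^m)^{n−1} and a coordinate permutation π — that is an isometric copy of X, is itself an isometric copy of X in {0,1}^{mn}. -/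
namespace Stmt18

def Tl {α : Type} (F : Set (Set α)) (A : Set α) : Prop :=
  ∃ P : Set (Set α), P ⊆ F ∧ P.PairwiseDisjoint id ∧ ⋃₀ P = A

def PF {α β : Type} (F : Set (Set α)) (G : Set (Set β)) : Set (Set (α × β)) :=
  {C | (∃ A ∈ F, ∃ y, C = A ×ˢ {y}) ∨ ∃ B ∈ G, ∃ x, C = {x} ×ˢ B}

theorem Tl.of_mem {α : Type} {F : Set (Set α)} {A : Set α} (h : A ∈ F) : Tl F A :=
  ⟨{A}, by simpa using h, by simp, by simp⟩

theorem Tl.empty {α : Type} {F : Set (Set α)} : Tl F ∅ :=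
  ⟨∅, by simp, by simp, by simp⟩

theorem Tl.congr {α : Type} {F : Set (Set α)} {A B : Set α} (h : Tl F A)
    (hB : ∀ x, x ∈ B ↔ x ∈ A) : Tl F B := by
  have : B = A := Set.ext hB
  rwa [this]

theorem Tl.iUnion {α ι : Type} {F : Set (Set α)} {A : ι → Set α}
    (h : ∀ i, Tl F (A i)) (hd : ∀ i j x, x ∈ A i → x ∈ A j → i = j) : Tl F (⋃ i, A i) := by
  choose P hP hPd hPu using h
  refine ⟨⋃ i, P i, by simpa using hP, ?_, ?_⟩
  · intro a ha b hb hab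
    obtain ⟨i, hi⟩ := Set.mem_iUnion.1 ha
    obtain ⟨j, hj⟩ := Set.mem_iUnion.1 hb
    by_cases hij : i = j
    · subst hij
      exact hPd i hi hj hab
    · refine Set.disjoint_left.2 fun x hx hy => hij ?_
      refine hd i j x ?_ ?_
      · rw [← hPu i]; exact ⟨a, hi, hx⟩
      · rw [← hPu j]; exact ⟨b, hj, hy⟩
  · ext x
    simp only [← hPu, Set.mem_sUnion, Set.mem_iUnion]
    constructor
    · rintro ⟨t, ⟨i, hi⟩, hx⟩; exact ⟨i, t, hi, hx⟩
    · rintro ⟨i, t, hi, hx⟩; exact ⟨t, ⟨i, hi⟩, hx⟩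

theorem Tl.union {α : Type} {F : Set (Set α)} {A B : Set α}
    (hA : Tl F A) (hB : Tl F B) (hd : ∀ x, x ∈ A → x ∉ B) : Tl F (A ∪ B) := by
  have := Tl.iUnion (F := F) (A := fun b : Bool => cond b A B)
    (by rintro (_ | _) <;> assumption)
    (by
      rintro (_ | _) (_ | _) x hx hy <;> simp at *
      · exact hd x hy hx
      · exact hd x hx hy)
  rwa [Set.union_eq_iUnion]

theorem Tl.col {α β : Type} {F : Set (Set α)} {G : Set (Set β)} {D : Set (α × β)}
    (h : ∀ y, Tl F {x | (x, y) ∈ D}) : Tl (PF F G) D := by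
  have key : ∀ y, Tl (PF F G) ({x | (x, y) ∈ D} ×ˢ {y}) := by
    intro y
    obtain ⟨P, hP, hd, hu⟩ := h y
    refine ⟨(fun A => A ×ˢ {y}) '' P, ?_, ?_, ?_⟩
    · rintro _ ⟨A, hA, rfl⟩
      exact Or.inl ⟨A, hP hA, y, rfl⟩
    · rintro _ ⟨A, hA, rfl⟩ _ ⟨B, hB, rfl⟩ hab
      have hne : A ≠ B := fun e => hab (by rw [e])
      have := Set.disjoint_left.1 (hd hA hB hne)
      refine Set.disjoint_left.2 ?_
      rintro ⟨a, b⟩ ⟨h1, _⟩ ⟨h2, _⟩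
      exact this h1 h2
    · rw [← hu]
      ext ⟨a, b⟩
      simp only [Set.mem_sUnion, Set.mem_image, Set.mem_prod, Set.mem_singleton_iff]
      constructor
      · rintro ⟨_, ⟨A, hA, rfl⟩, h1, h2⟩; exact ⟨⟨A, hA, h1⟩, h2⟩
      · rintro ⟨⟨A, hA, h1⟩, h2⟩; exact ⟨_, ⟨A, hA, rfl⟩, h1, h2⟩
  have h2 := Tl.iUnion key (by
    rintro i j ⟨a, b⟩ ⟨_, h1⟩ ⟨_, h2⟩
    simp at h1 h2
    exact h1.symm.trans h2)
  convert h2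
  ext ⟨a, b⟩
  simp

theorem Tl.row {α β : Type} {F : Set (Set α)} {G : Set (Set β)} {D : Set (α × β)}
    (h : ∀ x, Tl G {y | (x, y) ∈ D}) : Tl (PF F G) D := by
  have key : ∀ x, Tl (PF F G) ({x} ×ˢ {y | (x, y) ∈ D}) := by
    intro y
    obtain ⟨P, hP, hd, hu⟩ := h y
    refine ⟨(fun A => {y} ×ˢ A) '' P, ?_, ?_, ?_⟩
    · rintro _ ⟨A, hA, rfl⟩
      exact Or.inr ⟨A, hP hA, y, rfl⟩
    · rintro _ ⟨A, hA, rfl⟩ _ ⟨B, hB, rfl⟩ hab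
      have hne : A ≠ B := fun e => hab (by rw [e])
      have := Set.disjoint_left.1 (hd hA hB hne)
      refine Set.disjoint_left.2 ?_
      rintro ⟨a, b⟩ ⟨_, h1⟩ ⟨_, h2⟩
      exact this h1 h2
    · rw [← hu]
      ext ⟨a, b⟩
      simp
  have h2 := Tl.iUnion key (by
    rintro i j ⟨a, b⟩ ⟨h1, _⟩ ⟨h2, _⟩
    simp at h1 h2
    exact h1.symm.trans h2)
  convert h2
  ext ⟨a, b⟩
  simp

/-- rows part and columns part -/
theorem Tl.colrow {α β : Type} {F : Set (Set α)} {G : Set (Set β)} {D : Set (α × β)}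
    (D1 D2 : Set (α × β)) (h1 : ∀ y, Tl F {x | (x, y) ∈ D1}) (h2 : ∀ x, Tl G {y | (x, y) ∈ D2})
    (hd : ∀ p, p ∈ D1 → p ∉ D2) (hD : ∀ p, p ∈ D ↔ p ∈ D1 ∨ p ∈ D2) : Tl (PF F G) D := by
  have : D = D1 ∪ D2 := by ext p; exact hD p
  rw [this]
  exact (Tl.col h1).union (Tl.row h2) hd

theorem Tl.ite {α : Type} {F : Set (Set α)} {A : Set α} (c : Prop) (h : c → Tl F A) :
    Tl F {x | c ∧ x ∈ A} := by
  by_cases hc : c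
  · simpa [hc] using h hc
  · simpa [hc] using Tl.empty

/-- two disjoint sets with tileable complement -/
theorem two_holes (K : ∀ α : Type, Set (Set α) → Prop)
    (Kprod : ∀ (α β : Type) F G, K α F → K β G → K (α × β) (PF F G))
    {S : Type} (F0 : Set (Set S)) (hK : K S F0) (l : List (Set S)) (hl : ∀ A ∈ l, A ∈ F0) :
    ∃ (α : Type) (F : Set (Set α)) (co : α → Set S) (V0 V1 : Set α), K α F ∧
      (∀ A ∈ F0, Tl F {x | ∃ c ∈ co x, c ∈ A}) ∧ Tl F V0ᶜ ∧ Tl F V1ᶜ ∧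
      ∀ x, x ∈ V0 → x ∈ V1 → ∃ c ∈ co x, ∀ A ∈ l, c ∉ A := by
  induction l with
  | nil =>
    refine ⟨S, F0, fun x => {x}, Set.univ, Set.univ, hK, ?_, ?_, ?_, ?_⟩
    · intro A hA
      simpa using Tl.of_mem hA
    · simpa using Tl.empty
    · simpa using Tl.empty
    · intro x _ _
      simp
  | cons B l ih =>
    obtain ⟨α, F, co, V0, V1, hKF, hco, h0, h1, hE⟩ := ih (fun A hA => hl A (by simp [hA]))
    have hB : B ∈ F0 := hl B (by simp)
    have hQ := hco B hB
    set Q : Set α := {x | ∃ c ∈ co x, c ∈ B} with hQdef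
    refine ⟨α × α, PF F F, fun p => co p.1 ∪ co p.2,
      {p | (p.1 ∈ V0 ∧ p.2 ∈ V0 ∧ ¬ (p.1 ∈ Q ∧ p.2 ∈ Q ∧ p.2 ∈ V1)) ∨
        (p.1 ∉ V0 ∧ p.1 ∉ Q ∧ p.2 ∈ V0 ∧ p.2 ∈ V1 ∧ p.2 ∈ Q)},
      {p | p.1 ∈ V1 ∧ (p.1 ∈ V0 → p.2 ∈ V1) ∧ (p.1 ∉ V0 → p.2 ∉ Q)},
      Kprod _ _ _ _ hKF hKF, ?_, ?_, ?_, ?_⟩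
    · intro A hA
      have hA' := hco A hA
      refine Tl.colrow {p | ∃ c ∈ co p.1, c ∈ A}
        {p | (¬ ∃ c ∈ co p.1, c ∈ A) ∧ p.2 ∈ {x | ∃ c ∈ co x, c ∈ A}} ?_ ?_ ?_ ?_
      · intro y; exact hA'
      · intro x; exact (Tl.ite (¬ ∃ c ∈ co x, c ∈ A) (fun _ => hA')).congr (fun y => Iff.rfl)
      · rintro p hp ⟨h, _⟩; exact h hp
      · rintro p
        simp only [Set.mem_ofPred_eq, Set.mem_union]
        constructor
        · rintro ⟨c, h | h, hc⟩
          · exact Or.inl ⟨c, h, hc⟩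
          · by_cases h' : ∃ c ∈ co p.1, c ∈ A
            · exact Or.inl h'
            · exact Or.inr ⟨h', c, h, hc⟩
        · rintro (⟨c, h, hc⟩ | ⟨_, c, h, hc⟩)
          · exact ⟨c, Or.inl h, hc⟩
          · exact ⟨c, Or.inr h, hc⟩
    · refine Tl.colrow {p | ((p.2 ∈ V0 ∧ p.2 ∈ V1 ∧ p.2 ∈ Q) ∧ p.1 ∈ Q) ∨
          (¬ (p.2 ∈ V0 ∧ p.2 ∈ V1 ∧ p.2 ∈ Q) ∧ p.1 ∈ V0ᶜ)}
        {p | p.1 ∈ V0 ∧ p.2 ∈ V0ᶜ} ?_ ?_ ?_ ?_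
      · intro y
        by_cases hy : (y ∈ V0 ∧ y ∈ V1 ∧ y ∈ Q)
        · refine hQ.congr (fun x => ?_)
          simp only [Set.mem_ofPred_eq, hy]
          tauto
        · refine h0.congr (fun x => ?_)
          simp only [Set.mem_ofPred_eq, hy]
          tauto
      · intro x; exact (Tl.ite (x ∈ V0) (fun _ => h0)).congr (fun y => Iff.rfl)
      · rintro ⟨x, y⟩
        simp only [Set.mem_ofPred_eq, Set.mem_compl_iff]
        tauto
      · rintro ⟨x, y⟩
        simp only [Set.mem_ofPred_eq, Set.mem_compl_iff]
        tauto
    · refine Tl.colrow {p | p.1 ∈ V1ᶜ}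
        {p | (p.1 ∈ V1 ∧ p.1 ∈ V0 ∧ p.2 ∈ V1ᶜ) ∨ (p.1 ∈ V1 ∧ p.1 ∉ V0 ∧ p.2 ∈ Q)} ?_ ?_ ?_ ?_
      · intro y; exact h1
      · intro x
        by_cases hx : x ∈ V1
        · by_cases hx0 : x ∈ V0
          · refine h1.congr (fun y => ?_)
            simp only [Set.mem_ofPred_eq, hx, hx0]
            tauto
          · simp only [Set.mem_ofPred_eq, hx, hx0]
            simpa using hQ
        · simp only [Set.mem_ofPred_eq, hx]
          simpa using Tl.empty
      · rintro ⟨x, y⟩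
        simp only [Set.mem_ofPred_eq, Set.mem_compl_iff]
        tauto
      · rintro ⟨x, y⟩
        simp only [Set.mem_ofPred_eq, Set.mem_compl_iff]
        tauto
    · rintro ⟨x, y⟩ hx hy
      have hmain : (x ∈ V0 ∧ x ∈ V1 ∧ x ∉ Q) ∨ (y ∈ V0 ∧ y ∈ V1 ∧ y ∉ Q) := by
        simp only [Set.mem_ofPred_eq] at hx hy
        tauto
      rcases hmain with ⟨a, b, c⟩ | ⟨a, b, c⟩
      · obtain ⟨s, hs, hsl⟩ := hE x a b
        refine ⟨s, Or.inl hs, ?_⟩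
        intro A hA
        rcases List.mem_cons.1 hA with rfl | hA
        · exact fun h => c ⟨s, hs, h⟩
        · exact hsl A hA
      · obtain ⟨s, hs, hsl⟩ := hE y a b
        refine ⟨s, Or.inr hs, ?_⟩
        intro A hA
        rcases List.mem_cons.1 hA with rfl | hA
        · exact fun h => c ⟨s, hs, h⟩
        · exact hsl A hA

def Chain {α : Type} (F : Set (Set α)) (p : α → ℕ) (L : ℕ) : Prop :=
  (∀ x, p x ≤ L) ∧ ∀ i, i < L → Tl F {x | p x = i ∨ p x = i + 1}

theorem Chain.interval {α : Type} {F : Set (Set α)} {p : α → ℕ} {L : ℕ} (h : Chain F p L)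
    (a l : ℕ) (hl : a + 2 * l ≤ L + 1) : Tl F {x | a ≤ p x ∧ p x < a + 2 * l} := by
  induction l with
  | zero =>
    convert Tl.empty
    ext x; simp
  | succ l ih =>
    have := (ih (by omega)).union (h.2 (a + 2 * l) (by omega)) (by
      intro x; simp only [Set.mem_ofPred_eq]; omega)
    convert this using 1
    ext x
    simp only [Set.mem_ofPred_eq, Set.mem_union]; omega

/-- long chains; `L = 2 R`. -/
theorem long_chain (K : ∀ α : Type, Set (Set α) → Prop)
    (Kprod : ∀ (α β : Type) F G, K α F → K β G → K (α × β) (PF F G))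
    {α : Type} {F : Set (Set α)} (hK : K α F) {V0 V1 : Set α} (h0 : Tl F V0ᶜ) (h1 : Tl F V1ᶜ)
    (hd : ∀ x, x ∈ V0 → x ∉ V1) (n : ℕ) :
    ∃ (β : Type) (G : Set (Set β)) (p : β → ℕ) (R : ℕ), K β G ∧ n ≤ R ∧ Chain G p (2 * R) := by
  classical
  set q : α → ℕ := fun x => if x ∈ V0 then 0 else if x ∈ V1 then 2 else 1 with hq
  have hq0 : ∀ x, q x = 0 ↔ x ∈ V0 := by intro x; simp only [hq]; split_ifs <;> simp_all
  have hq2 : ∀ x, q x = 2 ↔ x ∈ V1 := by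
    intro x; have := hd x; simp only [hq]; split_ifs <;> simp_all
  have hqle : ∀ x, q x ≤ 2 := by intro x; simp only [hq]; split_ifs <;> simp
  have hchain : Chain F q 2 := by
    refine ⟨hqle, ?_⟩
    intro i hi
    interval_cases i
    · convert h1 using 1
      ext x
      have := hq2 x; have := hqle x
      simp only [Set.mem_ofPred_eq, Set.mem_compl_iff]
      rw [← hq2]; omega
    · convert h0 using 1
      ext x
      have := hqle x
      simp only [Set.mem_ofPred_eq, Set.mem_compl_iff]
      rw [← hq0]; omega
  induction n with
  | zero => exact ⟨α, F, q, 1, hK, by simp, hchain⟩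
  | succ n ih =>
    obtain ⟨β, G, p, R, hKG, hR, hp⟩ := ih
    have hpl := hp.1
    refine ⟨β × α, PF G F, fun z => (2 * R + 1) * q z.2 +
      (if q z.2 = 1 then 2 * R - p z.1 else p z.1), 3 * R + 1, Kprod _ _ _ _ hKG hK, by omega, ?_, ?_⟩
    · rintro ⟨x, y⟩
      have h1 := hpl x
      have h2 := hqle y
      dsimp only
      interval_cases h : q y <;> simp <;> omega
    · intro i hi
      by_cases hi1 : i = 2 * R ∨ i = 4 * R + 1
      · -- a jump between layers
        refine Tl.row ?_
        intro x
        have h1 := hpl x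
        rcases hi1 with rfl | rfl
        · by_cases hx : p x = 2 * R
          · convert hchain.2 0 (by omega) using 1
            ext y
            have h2 := hqle y
            simp only [Set.mem_ofPred_eq]
            interval_cases h : q y <;> simp <;> omega
          · convert Tl.empty using 1
            ext y
            have h2 := hqle y
            simp only [Set.mem_ofPred_eq, Set.mem_empty_iff_false, iff_false]
            interval_cases h : q y <;> simp <;> omega
        · by_cases hx : p x = 0
          · convert hchain.2 1 (by omega) using 1
            ext y
            have h2 := hqle y
            simp only [Set.mem_ofPred_eq]
            interval_cases h : q y <;> simp <;> omega
          · convert Tl.empty using 1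
            ext y
            have h2 := hqle y
            simp only [Set.mem_ofPred_eq, Set.mem_empty_iff_false, iff_false]
            interval_cases h : q y <;> simp <;> omega
      · refine Tl.col ?_
        intro y
        have h2 := hqle y
        simp only [Set.mem_ofPred_eq]
        interval_cases h : q y
        · by_cases hh : i < 2 * R
          · convert hp.2 i hh using 1
            ext x
            simp
          · convert Tl.empty using 1
            ext x
            have h1 := hpl x
            simp
            omega
        · by_cases hh : 2 * R < i ∧ i < 4 * R + 1
          · convert hp.2 (4 * R - i) (by omega) using 1
            ext x
            have h1 := hpl x
            simp
            omega
          · convert Tl.empty using 1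
            ext x
            have h1 := hpl x
            simp
            omega
        · by_cases hh : 4 * R + 1 < i
          · convert hp.2 (i - (4 * R + 2)) (by omega) using 1
            ext x
            have h1 := hpl x
            simp
            omega
          · convert Tl.empty using 1
            ext x
            have h1 := hpl x
            simp
            omega

end Stmt18

namespace Stmt18

theorem grid {α β : Type} {F : Set (Set α)} {G : Set (Set β)} {p : α → ℕ} {q : β → ℕ} {R C : ℕ}
    (hp : Chain F p (2 * R)) (hq : Chain G q (2 * C)) (O : ℕ → ℕ → Prop) (T : ℕ → ℕ → Prop)
    (h1 : ∀ j i, O j i → j < 2 * C) (h2 : ∀ j i, O j i → ¬ O (j + 1) i)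
    (h3 : ∀ j i, O j i → T i j ∧ T i (j + 1))
    (h4 : ∀ j, j ≤ 2 * C → ∃ a l, a + 2 * l ≤ 2 * R + 1 ∧ ∀ i, i ≤ 2 * R →
      ((T i j ∧ ¬ O j i ∧ ¬ (∃ j', j = j' + 1 ∧ O j' i)) ↔ (a ≤ i ∧ i < a + 2 * l))) :
    Tl (PF F G) {z | T (p z.1) (q z.2)} := by
  refine Tl.colrow
    {z | T (p z.1) (q z.2) ∧ ¬ O (q z.2) (p z.1) ∧ ¬ (∃ j', q z.2 = j' + 1 ∧ O j' (p z.1))}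
    {z | O (q z.2) (p z.1) ∨ (∃ j', q z.2 = j' + 1 ∧ O j' (p z.1))} ?_ ?_ ?_ ?_
  · intro y
    obtain ⟨a, l, hal, h⟩ := h4 (q y) (hq.1 y)
    refine (hp.interval a l hal).congr (fun x => ?_)
    simp only [Set.mem_ofPred_eq]
    exact h (p x) (hp.1 x)
  · intro x
    have := Tl.iUnion (F := G) (ι := {j // O j (p x)})
      (A := fun j => {y | q y = j.1 ∨ q y = j.1 + 1})
      (fun j => hq.2 j.1 (h1 _ _ j.2))
      (by
        rintro ⟨i, hi⟩ ⟨j, hj⟩ y hy hy'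
        simp only [Set.mem_ofPred_eq] at hy hy'
        have hi' := h2 _ _ hi
        have hj' := h2 _ _ hj
        have e1 : j ≠ i + 1 := by rintro rfl; exact hi' hj
        have e2 : i ≠ j + 1 := by rintro rfl; exact hj' hi
        have : i = j := by omega
        exact Subtype.ext this)
    refine this.congr (fun y => ?_)
    simp only [Set.mem_ofPred_eq, Set.mem_iUnion]
    constructor
    · rintro (h | ⟨j, h, hj⟩)
      · exact ⟨⟨_, h⟩, Or.inl rfl⟩
      · exact ⟨⟨_, hj⟩, Or.inr h⟩
    · rintro ⟨⟨j, hj⟩, h | h⟩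
      · exact Or.inl (by rw [h]; exact hj)
      · exact Or.inr ⟨j, h, hj⟩
  · rintro ⟨x, y⟩ h h'
    simp only [Set.mem_ofPred_eq] at h h'
    exact h'.elim h.2.1 h.2.2
  · rintro ⟨x, y⟩
    simp only [Set.mem_ofPred_eq]
    constructor
    · tauto
    · rintro (h | h | ⟨j, h, hj⟩)
      · exact h.1
      · exact (h3 _ _ h).1
      · rw [h]; exact (h3 _ _ hj).2

theorem token {α β : Type} {F : Set (Set α)} {G : Set (Set β)} {p : α → ℕ} {q : β → ℕ} {R C n : ℕ}
    (hp : Chain F p (2 * R)) (hq : Chain G q (2 * C)) (hR : n + 3 ≤ R) (hC : n ≤ C)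
    (I J : ℕ → Prop) (κ : ℕ → ℕ) (k0 : κ 0 = 1) (kn : ∀ c, n ≤ c → κ c = 0)
    (kb : ∀ c, κ c ≤ n + 1) (kI : ∀ c, I c → κ c = κ (c + 1) + 1)
    (kJ : ∀ c, J c → 1 ≤ κ c ∧ κ (c + 1) = κ c + 1)
    (kN : ∀ c, ¬ I c → ¬ J c → κ (c + 1) = κ c) :
    Tl (PF F G) {z | ¬ (p z.1 = 2 * R ∧ ∃ c, I c ∧ q z.2 = 2 * c) ∧
      ¬ (p z.1 + 1 = 2 * R ∧ ∃ c, J c ∧ q z.2 = 2 * c)} := by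
  obtain ⟨O, hOe, hOo⟩ : ∃ O : ℕ → ℕ → Prop,
      (∀ c i, O (2 * c) i ↔ c < C ∧ ((i % 2 = 0 ∧ i + 2 ≤ 2 * κ c ∧ (I c → i + 4 ≤ 2 * κ c)) ∨
        (J c ∧ i = 2 * R))) ∧
      (∀ c i, O (2 * c + 1) i ↔ c < C ∧ (κ (c + 1) = 0 ∨ (i % 2 = 1 ∧ i + 2 < 2 * κ (c + 1)))) := by
    refine ⟨fun j i => if j % 2 = 0 then (j / 2 < C ∧ ((i % 2 = 0 ∧ i + 2 ≤ 2 * κ (j / 2) ∧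
      (I (j / 2) → i + 4 ≤ 2 * κ (j / 2))) ∨ (J (j / 2) ∧ i = 2 * R))) else
      (j / 2 < C ∧ (κ (j / 2 + 1) = 0 ∨ (i % 2 = 1 ∧ i + 2 < 2 * κ (j / 2 + 1)))), ?_, ?_⟩
    · intro c i
      have e1 : (2 * c) % 2 = 0 := by omega
      have e2 : (2 * c) / 2 = c := by omega
      simp only [e1, e2, if_true]
    · intro c i
      have e1 : (2 * c + 1) % 2 = 1 := by omega
      have e2 : (2 * c + 1) / 2 = c := by omega
      simp [e1, e2]
  obtain ⟨T, hT, hTe, hTo⟩ : ∃ T : ℕ → ℕ → Prop,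
      (∀ i j, T i j ↔ ¬ (i = 2 * R ∧ ∃ c, I c ∧ j = 2 * c) ∧
        ¬ (i + 1 = 2 * R ∧ ∃ c, J c ∧ j = 2 * c)) ∧
      (∀ i c, T i (2 * c) ↔ ¬ (i = 2 * R ∧ I c) ∧ ¬ (i + 1 = 2 * R ∧ J c)) ∧
      ∀ i c, T i (2 * c + 1) := by
    refine ⟨_, fun i j => Iff.rfl, ?_, ?_⟩
    · intro i c
      have e : ∀ Q : ℕ → Prop, (∃ c', Q c' ∧ 2 * c = 2 * c') ↔ Q c := by
        intro Q
        constructor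
        · rintro ⟨c', h, h'⟩
          have : c = c' := by omega
          rwa [this]
        · intro h; exact ⟨c, h, rfl⟩
      simp only [e]
    · intro i c
      refine ⟨?_, ?_⟩
      · rintro ⟨_, c', _, h⟩; omega
      · rintro ⟨_, c', _, h⟩; omega
  have par : ∀ j, ∃ c, j = 2 * c ∨ j = 2 * c + 1 := fun j => ⟨j / 2, by omega⟩
  refine (grid hp hq O T ?_ ?_ ?_ ?_).congr ?_
  · intro j i h
    obtain ⟨c, rfl | rfl⟩ := par j
    · have := ((hOe _ _).1 h).1; omega
    · have := ((hOo _ _).1 h).1; omega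
  · intro j i h h'
    obtain ⟨c, rfl | rfl⟩ := par j
    · rw [hOe] at h
      rw [hOo] at h'
      have a1 := kI c; have a2 := kJ c; have a3 := kN c
      have a4 := kb (c + 1)
      by_cases hI : I c <;> by_cases hJ : J c <;> simp [hI, hJ] at h a1 a2 a3 <;> omega
    · rw [show 2 * c + 1 + 1 = 2 * (c + 1) by ring, hOe] at h'
      rw [hOo] at h
      have a1 := kI (c + 1); have a2 := kJ (c + 1); have a3 := kN (c + 1)
      have a4 := kb (c + 1)
      by_cases hI : I (c + 1) <;> by_cases hJ : J (c + 1) <;> simp [hI, hJ] at h' a1 a2 a3 <;> omega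
  · intro j i h
    obtain ⟨c, rfl | rfl⟩ := par j
    · refine ⟨?_, hTo _ _⟩
      rw [hTe]
      rw [hOe] at h
      have a1 := kI c; have a2 := kJ c; have a3 := kN c
      have a4 := kb c
      by_cases hI : I c <;> by_cases hJ : J c <;> simp [hI, hJ] at h a1 a2 a3 ⊢ <;> omega
    · refine ⟨hTo _ _, ?_⟩
      rw [show 2 * c + 1 + 1 = 2 * (c + 1) by ring, hTe]
      rw [hOo] at h
      have a1 := kI (c + 1); have a2 := kJ (c + 1); have a3 := kN (c + 1)
      have a4 := kb (c + 1)
      by_cases hI : I (c + 1) <;> by_cases hJ : J (c + 1) <;> simp [hI, hJ] at h a1 a2 a3 ⊢ <;> omega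
  · intro j hj
    obtain ⟨c, rfl | rfl⟩ := par j
    · have a1 := kI c; have a2 := kJ c; have a3 := kN c
      have a4 := kb c
      have a5 : κ c ≠ 0 → c < n := fun h => by
        by_contra h'; exact h (kn c (by omega))
      have hin : ∀ i, (∃ j', 2 * c = j' + 1 ∧ O j' i) ↔
          (κ c = 0 ∨ (i % 2 = 1 ∧ i + 2 < 2 * κ c)) := by
        intro i
        rcases c with _ | c
        · simp [k0]
        · constructor
          · rintro ⟨j', h, h'⟩
            have : j' = 2 * c + 1 := by omega
            subst this
            exact ((hOo _ _).1 h').2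
          · intro h
            exact ⟨2 * c + 1, by ring, (hOo _ _).2 ⟨by omega, h⟩⟩
      simp only [hin, hOe, hTe]
      by_cases hk : κ c = 0
      · exact ⟨0, 0, by omega, fun i hi => by simp [hk]⟩
      by_cases hI : I c
      · have hJ : ¬ J c := fun hJ => by have := a1 hI; have := a2 hJ; omega
        refine ⟨2 * κ c - 2, R - κ c + 1, by omega, fun i hi => ?_⟩
        simp [hI, hJ] at a1 a2 a3 ⊢
        omega
      by_cases hJ : J c
      · refine ⟨2 * κ c - 1, R - κ c, by omega, fun i hi => ?_⟩
        simp [hI, hJ] at a1 a2 a3 ⊢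
        omega
      · refine ⟨2 * κ c - 1, R - κ c + 1, by omega, fun i hi => ?_⟩
        simp [hI, hJ] at a1 a2 a3 ⊢
        omega
    · have a1 := kI c; have a2 := kJ c; have a3 := kN c
      have a4 := kb c
      have a5 := kb (c + 1)
      have hin : ∀ i, (∃ j', 2 * c + 1 = j' + 1 ∧ O j' i) ↔ O (2 * c) i := by
        intro i
        constructor
        · rintro ⟨j', h, h'⟩
          have : j' = 2 * c := by omega
          rwa [← this]
        · intro h
          exact ⟨_, rfl, h⟩
      simp only [hin, hOe, hOo, hTo]
      by_cases hk : κ (c + 1) = 0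
      · exact ⟨0, 0, by omega, fun i hi => by simp [hk]; omega⟩
      by_cases hI : I c
      · have hJ : ¬ J c := fun hJ => by have := a1 hI; have := a2 hJ; omega
        refine ⟨2 * κ c - 3, R - κ c + 2, by simp [hI] at a1; omega, fun i hi => ?_⟩
        simp [hI, hJ] at a1 a2 a3 ⊢
        omega
      by_cases hJ : J c
      · refine ⟨2 * κ c, R - κ c, by omega, fun i hi => ?_⟩
        simp [hI, hJ] at a1 a2 a3 ⊢
        omega
      · refine ⟨2 * κ c - 1, R - κ c + 1, by simp [hI, hJ] at a3; omega, fun i hi => ?_⟩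
        simp [hI, hJ] at a1 a2 a3 ⊢
        omega
  · rintro ⟨x, y⟩
    exact (hT _ _).symm

end Stmt18

namespace Stmt18

theorem final1 {α β β' : Type} {F : Set (Set α)} {G : Set (Set β)} {G' : Set (Set β')}
    {p : β → ℕ} {q : β' → ℕ} {R C n : ℕ}
    (hp : Chain G p (2 * R)) (hq : Chain G' q (2 * C)) (hR : n + 3 ≤ R) (hC : n ≤ C)
    (U W : ℕ → Set α) (hU : ∀ c, Tl F (U c)) (hW : ∀ c, Tl F (W c))
    (h : ∀ x, ∃ κ : ℕ → ℕ, κ 0 = 1 ∧ (∀ c, n ≤ c → κ c = 0) ∧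
      (∀ c, κ c ≤ n + 1) ∧ (∀ c, x ∈ U c → κ c = κ (c + 1) + 1) ∧
      (∀ c, x ∈ W c → 1 ≤ κ c ∧ κ (c + 1) = κ c + 1) ∧
      (∀ c, x ∉ U c → x ∉ W c → κ (c + 1) = κ c)) :
    Tl (PF F (PF G G')) Set.univ := by
  refine Tl.colrow
    {z | (p z.2.1 = 2 * R ∧ ∃ c, z.1 ∈ U c ∧ q z.2.2 = 2 * c) ∨
      (p z.2.1 + 1 = 2 * R ∧ ∃ c, z.1 ∈ W c ∧ q z.2.2 = 2 * c)}
    {z | ¬ (p z.2.1 = 2 * R ∧ ∃ c, z.1 ∈ U c ∧ q z.2.2 = 2 * c) ∧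
      ¬ (p z.2.1 + 1 = 2 * R ∧ ∃ c, z.1 ∈ W c ∧ q z.2.2 = 2 * c)} ?_ ?_ ?_ ?_
  · rintro ⟨u, v⟩
    by_cases hv : ∃ c, q v = 2 * c
    · obtain ⟨c, hc⟩ := hv
      have e : ∀ Q : ℕ → Prop, (∃ c', Q c' ∧ q v = 2 * c') ↔ Q c := by
        intro Q
        constructor
        · rintro ⟨c', h, h'⟩
          have : c = c' := by omega
          rwa [this]
        · intro h; exact ⟨c, h, hc⟩
      by_cases h1 : p u = 2 * R
      · refine (hU c).congr (fun x => ?_)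
        simp only [Set.mem_ofPred_eq, e]
        constructor
        · rintro (h | h)
          · exact h.2
          · omega
        · intro h; exact Or.inl ⟨h1, h⟩
      by_cases h2 : p u + 1 = 2 * R
      · refine (hW c).congr (fun x => ?_)
        simp only [Set.mem_ofPred_eq, e]
        constructor
        · rintro (h | h)
          · omega
          · exact h.2
        · intro h; exact Or.inr ⟨h2, h⟩
      · refine Tl.empty.congr (fun x => ?_)
        simp [h1, h2]
    · refine Tl.empty.congr (fun x => ?_)
      simp only [Set.mem_ofPred_eq, Set.mem_empty_iff_false, iff_false]
      rintro (⟨_, c, _, h⟩ | ⟨_, c, _, h⟩) <;> exact hv ⟨c, h⟩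
  · intro x
    obtain ⟨κ, k1, k2, k3, k4, k5, k6⟩ := h x
    refine (token hp hq hR hC (fun c => x ∈ U c) (fun c => x ∈ W c) κ k1 k2 k3 k4 k5 k6).congr ?_
    intro z
    simp only [Set.mem_ofPred_eq]
  · intro z h h'
    simp only [Set.mem_ofPred_eq] at h h'
    exact h.elim h'.1 h'.2
  · intro z
    simp only [Set.mem_ofPred_eq, Set.mem_univ, true_iff]
    rw [← not_or]
    exact Classical.em _

open Classical in
theorem kappa {α : Type} (U W : ℕ → Set α) (b n : ℕ) (hbn : b ≤ n) (hW : ∀ c, b ≤ c → W c = ∅)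
    (hU : ∀ c, c < b → U c = ∅) (hU' : ∀ c, n ≤ c → U c = ∅) (x : α)
    (hx : (∑ i ∈ Finset.range n, if x ∈ U i then 1 else 0) =
      1 + ∑ i ∈ Finset.range b, if x ∈ W i then 1 else 0) :
    ∃ κ : ℕ → ℕ, κ 0 = 1 ∧ (∀ c, n ≤ c → κ c = 0) ∧
      (∀ c, κ c ≤ n + 1) ∧ (∀ c, x ∈ U c → κ c = κ (c + 1) + 1) ∧
      (∀ c, x ∈ W c → 1 ≤ κ c ∧ κ (c + 1) = κ c + 1) ∧
      (∀ c, x ∉ U c → x ∉ W c → κ (c + 1) = κ c) := by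
  set d : ℕ → ℕ := fun c => ∑ i ∈ Finset.range c, if x ∈ W i then 1 else 0 with hd
  set e : ℕ → ℕ := fun c => ∑ i ∈ Finset.range c, if x ∈ U i then 1 else 0 with he
  have d0 : d 0 = 0 := by simp [hd]
  have e0 : e 0 = 0 := by simp [he]
  have d1 : ∀ c, d (c + 1) = d c + if x ∈ W c then 1 else 0 := fun c => Finset.sum_range_succ _ _
  have e1 : ∀ c, e (c + 1) = e c + if x ∈ U c then 1 else 0 := fun c => Finset.sum_range_succ _ _
  have dm : Monotone d := monotone_nat_of_le_succ (fun c => by rw [d1]; omega)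
  have em : Monotone e := monotone_nat_of_le_succ (fun c => by rw [e1]; omega)
  have hx' : e n = 1 + d b := hx
  have db : ∀ c, b ≤ c → d c = d b := by
    intro c hc
    induction c, hc using Nat.le_induction with
    | base => rfl
    | succ c hc ih => rw [d1, hW c hc, ih]; simp
  have en : ∀ c, n ≤ c → e c = e n := by
    intro c hc
    induction c, hc using Nat.le_induction with
    | base => rfl
    | succ c hc ih => rw [e1, hU' c hc, ih]; simp
  have eb : ∀ c, c ≤ b → e c = 0 := by
    intro c hc
    induction c with
    | zero => exact e0
    | succ c ih => rw [e1, hU c (by omega), ih (by omega)]; simp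
  have dle : ∀ c, d c ≤ c := by
    intro c
    induction c with
    | zero => omega
    | succ c ih => rw [d1]; split_ifs <;> omega
  have dle' : ∀ c, d c ≤ d b := by
    intro c
    rcases le_total c b with h | h
    · exact dm h
    · rw [db c h]
  refine ⟨fun c => 1 + d c - e c, ?_, ?_, ?_, ?_, ?_, ?_⟩
  · simp [d0, e0]
  · intro c hc
    have := db c (by omega); have := en c hc
    dsimp only; omega
  · intro c
    have := dle' c; have := dle b
    dsimp only; omega
  · intro c hc
    have h1 : b ≤ c := by
      by_contra h; rw [hU c (by omega)] at hc; exact hc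
    have h2 : c < n := by
      by_contra h; rw [hU' c (by omega)] at hc; exact hc
    have := db c h1; have := db (c + 1) (by omega)
    have h3 := e1 c
    rw [if_pos hc] at h3
    have h4 : e (c + 1) ≤ e n := em (by omega)
    dsimp only; omega
  · intro c hc
    have h1 : c < b := by
      by_contra h; rw [hW c (by omega)] at hc; exact hc
    have := eb c (by omega); have := eb (c + 1) (by omega)
    have h3 := d1 c
    rw [if_pos hc] at h3
    dsimp only; omega
  · intro c h1 h2
    have h3 := d1 c; have h4 := e1 c
    rw [if_neg h2] at h3
    rw [if_neg h1] at h4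
    dsimp only; rw [h3, h4]; simp

open Classical in
theorem final2 {α β β' : Type} {F : Set (Set α)} {G : Set (Set β)} {G' : Set (Set β')}
    {p : β → ℕ} {q : β' → ℕ} {R C a b : ℕ}
    (hp : Chain G p (2 * R)) (hq : Chain G' q (2 * C)) (hR : b + a + 3 ≤ R) (hC : b + a ≤ C)
    (U : Fin a → Set α) (W : Fin b → Set α) (hU : ∀ c, U c ∈ F) (hW : ∀ c, W c ∈ F)
    (h : ∀ x, (∑ i, if x ∈ U i then 1 else 0) = 1 + ∑ i, if x ∈ W i then 1 else 0) :
    Tl (PF F (PF G G')) Set.univ := by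
  have hUT : ∀ i, Tl F (if h : b ≤ i ∧ i - b < a then U ⟨i - b, h.2⟩ else ∅) := by
    intro i
    split_ifs with h
    · exact Tl.of_mem (hU _)
    · exact Tl.empty
  have hWT : ∀ i, Tl F (if h : i < b then W ⟨i, h⟩ else ∅) := by
    intro i
    split_ifs with h
    · exact Tl.of_mem (hW _)
    · exact Tl.empty
  refine final1 hp hq hR hC _ _ hUT hWT ?_
  intro x
  refine kappa _ _ b (b + a) (by omega) ?_ ?_ ?_ x ?_
  · intro c hc; rw [dif_neg (by omega)]
  · intro c hc; rw [dif_neg (by omega)]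
  · intro c hc; rw [dif_neg (by omega)]
  · rw [Finset.sum_range_add, Finset.sum_range, Finset.sum_range, Finset.sum_range]
    have := h x
    rw [Finset.sum_eq_zero (s := (Finset.univ : Finset (Fin b)))]
    · rw [zero_add]
      simpa using this
    · intro i _
      rw [dif_neg (by have := i.2; omega)]
      simp

open Classical in
theorem final3 (K : ∀ α : Type, Set (Set α) → Prop)
    (Kprod : ∀ (α β : Type) F G, K α F → K β G → K (α × β) (PF F G))
    {α β : Type} {F : Set (Set α)} (hK : K α F)
    {G : Set (Set β)} (hKG : K β G) {V0 V1 : Set β} (h0 : Tl G V0ᶜ) (h1 : Tl G V1ᶜ)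
    (hd : ∀ x, x ∈ V0 → x ∉ V1)
    {ι ι' : Type} [Fintype ι] [Fintype ι'] 
    (U : ι → Set α) (W : ι' → Set α) (hU : ∀ c, U c ∈ F) (hW : ∀ c, W c ∈ F)
    (h : ∀ x, (∑ i, if x ∈ U i then 1 else 0) = 1 + ∑ i, if x ∈ W i then 1 else 0) :
    ∃ (γ : Type) (H : Set (Set γ)), K γ H ∧ Tl H Set.univ := by
  obtain ⟨β', G', p, R, hKG', hR, hch⟩ := long_chain K Kprod hKG h0 h1 hd
    (Fintype.card ι' + Fintype.card ι + 3)
  refine ⟨_, _, Kprod _ _ _ _ hK (Kprod _ _ _ _ hKG' hKG'), ?_⟩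
  refine final2 hch hch hR (by omega) (fun i => U ((Fintype.equivFin ι).symm i))
    (fun i => W ((Fintype.equivFin ι').symm i)) (fun _ => hU _) (fun _ => hW _) ?_
  intro x
  rw [Equiv.sum_comp (Fintype.equivFin ι).symm (fun i => if x ∈ U i then 1 else 0),
    Equiv.sum_comp (Fintype.equivFin ι').symm (fun i => if x ∈ W i then 1 else 0)]
  exact h x

theorem main_abs (K : ∀ α : Type, Set (Set α) → Prop)
    (Kprod : ∀ (α β : Type) F G, K α F → K β G → K (α × β) (PF F G))
    {S : Type} [Fintype S] [DecidableEq S] (F0 : Set (Set S)) (hK : K S F0) (r : ℕ) (hr : 0 < r)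
    (w w' : Finset S → ℕ) (hw : ∀ A, w A ≠ 0 → (A : Set S) ∈ F0)
    (hw' : ∀ A, w' A ≠ 0 → (A : Set S) ∈ F0)
    (hwr : ∀ x : S, ∑ A ∈ Finset.univ.filter (fun A : Finset S => x ∈ A), w A = r)
    (hwm : ∀ x : S, (∑ A ∈ Finset.univ.filter (fun A : Finset S => x ∈ A), w' A) ≡ 1 [MOD r]) :
    ∃ (γ : Type) (H : Set (Set γ)), K γ H ∧ Tl H Set.univ := by
  classical
  obtain ⟨β, G, co, V0, V1, hKG, -, h0, h1, hE⟩ := two_holes K Kprod F0 hK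
    (((Finset.univ.filter (fun A : Finset S => w A ≠ 0)).toList).map (fun A : Finset S => (A : Set S)))
    (by
      intro A hA
      simp only [List.mem_map, Finset.mem_toList, Finset.mem_filter] at hA
      obtain ⟨B, hB, rfl⟩ := hA
      exact hw B hB.2)
  have hd : ∀ x, x ∈ V0 → x ∉ V1 := by
    intro x hx hx'
    obtain ⟨c, -, hc⟩ := hE x hx hx'
    have : ∑ A ∈ Finset.univ.filter (fun A : Finset S => c ∈ A), w A = 0 := by
      refine Finset.sum_eq_zero ?_
      intro A hA
      by_contra hne
      refine hc A ?_ (by simpa using hA)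
      simp only [List.mem_map, Finset.mem_toList, Finset.mem_filter]
      exact ⟨A, ⟨Finset.mem_univ _, hne⟩, rfl⟩
    have := hwr c
    omega
  have hg : ∀ x : S, ∃ g : ℕ,
      (∑ A ∈ Finset.univ.filter (fun A : Finset S => x ∈ A), (w A + w' A)) = 1 + g * r := by
    intro x
    rw [Finset.sum_add_distrib, hwr x]
    set s := ∑ A ∈ Finset.univ.filter (fun A : Finset S => x ∈ A), w' A with hs
    have h := hwm x
    have h2 : 1 ≡ r + s [MOD r] := by
      have : (r + s) ≡ s [MOD r] := by simp [Nat.ModEq]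
      exact (this.trans h).symm
    obtain ⟨g, hg⟩ := (Nat.modEq_iff_dvd' (by omega)).1 h2
    exact ⟨g, by rw [mul_comm]; omega⟩
  choose g hg using hg
  refine final3 K Kprod (Kprod _ _ _ _ hK hK) hKG h0 h1 hd
    (ι := (Σ A : Finset S, Fin (w A + w' A)) × S)
    (ι' := (Σ x : S, Fin (g x)) × (Σ A : Finset S, Fin (w A)))
    (fun i => (i.1.1 : Set S) ×ˢ {i.2}) (fun i => {i.1.1} ×ˢ (i.2.1 : Set S)) ?_ ?_ ?_
  · rintro ⟨⟨A, l⟩, y⟩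
    refine Or.inl ⟨A, ?_, y, rfl⟩
    by_cases h : w A = 0
    · refine hw' A ?_
      have := l.2
      omega
    · exact hw A h
  · rintro ⟨⟨x, _⟩, ⟨A, l⟩⟩
    refine Or.inr ⟨A, hw A ?_, x, rfl⟩
    have := l.2
    omega
  · rintro ⟨x, y⟩
    have e1 : (∑ i : (Σ A : Finset S, Fin (w A + w' A)) × S,
        if (x, y) ∈ (i.1.1 : Set S) ×ˢ ({i.2} : Set S) then 1 else 0) = 1 + g x * r := by
      rw [← hg x, Fintype.sum_prod_type, Fintype.sum_sigma, Finset.sum_filter]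
      refine Finset.sum_congr rfl (fun A _ => ?_)
      by_cases hx : x ∈ A <;> simp [hx]
    have e2 : (∑ i : (Σ x : S, Fin (g x)) × (Σ A : Finset S, Fin (w A)),
        if (x, y) ∈ ({i.1.1} : Set S) ×ˢ (i.2.1 : Set S) then 1 else 0) = g x * r := by
      rw [← hwr y, Fintype.sum_prod_type, Fintype.sum_sigma]
      rw [Finset.sum_eq_single x]
      · simp only [Fintype.sum_sigma]
        simp [Finset.sum_filter]
      · intro b _ hb
        simp [hb.symm]
      · simp
    rw [← e2] at e1
    convert e1

end Stmt18

namespace Stmt18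

theorem hd_append {a b : ℕ} (x x' : Fin a → ZMod 2) (y y' : Fin b → ZMod 2) :
    hammingDist (Fin.append x y) (Fin.append x' y') = hammingDist x x' + hammingDist y y' := by
  simp only [hammingDist, Finset.card_filter]
  rw [Fin.sum_univ_add]
  simp

def KK {k : ℕ} (X : Set (Fin k → ZMod 2)) (α : Type) (F : Set (Set α)) : Prop :=
  ∃ (n : ℕ) (e : α ≃ (Fin n → ZMod 2)), ∀ A ∈ F, ∃ φ : (Fin k → ZMod 2) → (Fin n → ZMod 2),
    (∀ a b, hammingDist (φ a) (φ b) = hammingDist a b) ∧ φ '' X = e '' A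

theorem KK_prod {k : ℕ} (X : Set (Fin k → ZMod 2)) (α β : Type) (F : Set (Set α))
    (G : Set (Set β)) (hF : KK X α F) (hG : KK X β G) : KK X (α × β) (PF F G) := by
  obtain ⟨n, e, he⟩ := hF
  obtain ⟨n', e', he'⟩ := hG
  refine ⟨n + n', (e.prodCongr e').trans (Fin.appendEquiv n n'), ?_⟩
  rintro _ (⟨A, hA, y, rfl⟩ | ⟨B, hB, x, rfl⟩)
  · obtain ⟨φ, h1, h2⟩ := he A hA
    refine ⟨fun a => Fin.append (φ a) (e' y), ?_, ?_⟩
    · intro a b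
      rw [hd_append, h1]
      simp
    · have : (fun a => Fin.append (φ a) (e' y)) '' X = (fun u => Fin.append u (e' y)) '' (φ '' X) := by
        rw [Set.image_image]
      rw [this, h2, Set.image_image]
      ext u
      simp only [Set.mem_image, Prod.exists, Set.mem_prod, Set.mem_singleton_iff]
      constructor
      · rintro ⟨a, ha, rfl⟩
        exact ⟨a, y, ⟨ha, rfl⟩, rfl⟩
      · rintro ⟨a, _, ⟨ha, rfl⟩, rfl⟩
        exact ⟨a, ha, rfl⟩
  · obtain ⟨φ, h1, h2⟩ := he' B hB
    refine ⟨fun a => Fin.append (e x) (φ a), ?_, ?_⟩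
    · intro a b
      rw [hd_append, h1]
      simp
    · have : (fun a => Fin.append (e x) (φ a)) '' X = (fun u => Fin.append (e x) u) '' (φ '' X) := by
        rw [Set.image_image]
      rw [this, h2, Set.image_image]
      ext u
      simp only [Set.mem_image, Prod.exists, Set.mem_prod, Set.mem_singleton_iff]
      constructor
      · rintro ⟨a, ha, rfl⟩
        exact ⟨x, a, ⟨rfl, ha⟩, rfl⟩
      · rintro ⟨_, a, ⟨rfl, ha⟩, rfl⟩
        exact ⟨a, ha, rfl⟩

theorem part1 {k : ℕ} (X : Set (Fin k → ZMod 2)) {γ : Type} {H : Set (Set γ)} (hK : KK X γ H)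
    (hT : Tl H Set.univ) : ∃ n : ℕ, 0 < n ∧ ∃ P : Set (Set (Fin n → ZMod 2)),
      (∀ A ∈ P, ∃ φ : (Fin k → ZMod 2) → (Fin n → ZMod 2),
        (∀ a b, hammingDist (φ a) (φ b) = hammingDist a b) ∧ φ '' X = A) ∧
      (∀ x : Fin n → ZMod 2, ∃! A, A ∈ P ∧ x ∈ A) := by
  -- transport, then add one more coordinate
  obtain ⟨N, e0, he0⟩ := hK
  have key : ∃ (n : ℕ) (e : (γ × (Fin 1 → ZMod 2)) ≃ (Fin n → ZMod 2)), 0 < n ∧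
      ∀ A ∈ PF H (∅ : Set (Set (Fin 1 → ZMod 2))), ∃ φ : (Fin k → ZMod 2) → (Fin n → ZMod 2),
    (∀ a b, hammingDist (φ a) (φ b) = hammingDist a b) ∧ φ '' X = e '' A := by
    obtain ⟨n, e, h⟩ := KK_prod X γ (Fin 1 → ZMod 2) H ∅ ⟨N, e0, he0⟩
      ⟨1, Equiv.refl _, by simp⟩
    refine ⟨n, e, ?_, h⟩
    by_contra hn
    have hn0 : n = 0 := by omega
    subst hn0
    have hsub : Subsingleton (γ × (Fin 1 → ZMod 2)) := e.injective.subsingleton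
    have x : γ := e0.symm 0
    have := congrArg Prod.snd (hsub.elim (x, fun _ => 0) (x, fun _ => 1))
    have := congrFun this 0
    simp at this
  obtain ⟨n, e, hn, h⟩ := key
  have hT' : Tl (PF H (∅ : Set (Set (Fin 1 → ZMod 2)))) Set.univ :=
    Tl.col (fun y => hT.congr (fun x => by simp))
  obtain ⟨P, hP, hd, hu⟩ := hT'
  refine ⟨n, hn, (fun A => e '' A) '' P, ?_, ?_⟩
  · rintro _ ⟨A, hA, rfl⟩
    exact h A (hP hA)
  · intro x
    have : e.symm x ∈ ⋃₀ P := by rw [hu]; trivial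
    obtain ⟨A, hA, hx⟩ := this
    refine ⟨e '' A, ⟨⟨A, hA, rfl⟩, ⟨_, hx, by simp⟩⟩, ?_⟩
    rintro _ ⟨⟨B, hB, rfl⟩, ⟨z, hz, hzx⟩⟩
    have hzx' : z = e.symm x := by rw [← hzx]; simp
    subst hzx'
    have : B = A := by
      by_contra hne
      exact Set.disjoint_left.1 (hd hB hA hne) hz hx
    rw [this]

theorem part2 {k m : ℕ} (X : Set (Fin k → ZMod 2)) (Y : Set (Fin m → ZMod 2))
      (hY : ∃ φ : (Fin k → ZMod 2) → (Fin m → ZMod 2),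
        (∀ a b, hammingDist (φ a) (φ b) = hammingDist a b) ∧ φ '' X = Y)
      (n : ℕ) (i₀ : Fin n) (zf : Fin n → Fin m → ZMod 2) :
        ∃ ψ : (Fin k → ZMod 2) → (Fin n × Fin m → ZMod 2),
          (∀ a b, hammingDist (ψ a) (ψ b) = hammingDist a b) ∧
          ψ '' X = {g : Fin n × Fin m → ZMod 2 |
            (fun i => g (i₀, i)) ∈ Y ∧ ∀ j, j ≠ i₀ → ∀ i, g (j, i) = zf j i} := by
  obtain ⟨φ, h1, rfl⟩ := hY
  refine ⟨fun a z => if z.1 = i₀ then φ a z.2 else zf z.1 z.2, ?_, ?_⟩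
  · intro a b
    rw [← h1 a b]
    simp only [hammingDist, Finset.card_filter]
    rw [Fintype.sum_prod_type, Finset.sum_eq_single i₀]
    · simp
    · intro j _ hj
      simp [hj]
    · simp
  · ext g
    simp only [Set.mem_image, Set.mem_ofPred_eq]
    constructor
    · rintro ⟨a, ha, rfl⟩
      refine ⟨⟨a, ha, by simp⟩, ?_⟩
      intro j hj i
      simp [hj]
    · rintro ⟨⟨a, ha, hg⟩, hz⟩
      refine ⟨a, ha, ?_⟩
      funext ⟨j, i⟩
      by_cases hj : j = i₀
      · subst hj
        simp [hg]
      · simp [hj, hz j hj i]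

end Stmt18

theorem stmt_18 (k m : ℕ) (X : Finset (Fin k → ZMod 2)) (r : ℕ) (hr : 0 < r)
    -- an r-partition of {0,1}^m by isometric copies of X
    (hrp : ∃ w : Finset (Fin m → ZMod 2) → ℕ,
      (∀ A, w A ≠ 0 → ∃ φ : (Fin k → ZMod 2) → (Fin m → ZMod 2),
        (∀ a b, hammingDist (φ a) (φ b) = hammingDist a b) ∧ X.image φ = A) ∧
      (∀ x : Fin m → ZMod 2,
        ∑ A ∈ Finset.univ.filter (fun A : Finset (Fin m → ZMod 2) => x ∈ A), w A = r))
    -- a mod-r partition of {0,1}^m by isometric copies of X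
    (hmp : ∃ w : Finset (Fin m → ZMod 2) → ℕ,
      (∀ A, w A ≠ 0 → ∃ φ : (Fin k → ZMod 2) → (Fin m → ZMod 2),
        (∀ a b, hammingDist (φ a) (φ b) = hammingDist a b) ∧ X.image φ = A) ∧
      (∀ x : Fin m → ZMod 2,
        (∑ A ∈ Finset.univ.filter (fun A : Finset (Fin m → ZMod 2) => x ∈ A), w A)
          ≡ 1 [MOD r])) :
    -- {0,1}^n can be partitioned into isometric copies of X for some n
    (∃ n : ℕ, 0 < n ∧ ∃ P : Set (Set (Fin n → ZMod 2)),
      (∀ A ∈ P, ∃ φ : (Fin k → ZMod 2) → (Fin n → ZMod 2),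
        (∀ a b, hammingDist (φ a) (φ b) = hammingDist a b) ∧ φ '' ↑X = A) ∧
      (∀ x : Fin n → ZMod 2, ∃! A, A ∈ P ∧ x ∈ A)) ∧
    -- and concretely: any copy (in the product sense) of an isometric copy of X
    -- inside ({0,1}^m)^n is itself an isometric copy of X
    (∀ Y : Set (Fin m → ZMod 2),
      (∃ φ : (Fin k → ZMod 2) → (Fin m → ZMod 2),
        (∀ a b, hammingDist (φ a) (φ b) = hammingDist a b) ∧ φ '' ↑X = Y) →
      ∀ (n : ℕ) (i₀ : Fin n) (zf : Fin n → Fin m → ZMod 2),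
        ∃ ψ : (Fin k → ZMod 2) → (Fin n × Fin m → ZMod 2),
          (∀ a b, hammingDist (ψ a) (ψ b) = hammingDist a b) ∧
          ψ '' ↑X = {g : Fin n × Fin m → ZMod 2 |
            (fun i => g (i₀, i)) ∈ Y ∧ ∀ j, j ≠ i₀ → ∀ i, g (j, i) = zf j i}) := by
  classical
  refine ⟨?_, fun Y hY n i₀ zf => Stmt18.part2 _ Y hY n i₀ zf⟩
  obtain ⟨w, hw, hwr⟩ := hrp
  obtain ⟨w', hw', hwm⟩ := hmp
  have conv : ∀ A : Finset (Fin m → ZMod 2),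
      (∃ φ : (Fin k → ZMod 2) → (Fin m → ZMod 2),
        (∀ a b, hammingDist (φ a) (φ b) = hammingDist a b) ∧ X.image φ = A) →
      (A : Set (Fin m → ZMod 2)) ∈ {A : Set (Fin m → ZMod 2) |
        ∃ φ : (Fin k → ZMod 2) → (Fin m → ZMod 2),
        (∀ a b, hammingDist (φ a) (φ b) = hammingDist a b) ∧ φ '' (X : Set (Fin k → ZMod 2)) = A} := by
    rintro A ⟨φ, h1, h2⟩
    refine ⟨φ, h1, ?_⟩
    rw [← h2]
    simp
  obtain ⟨γ, H, hK, hT⟩ := Stmt18.main_abs (Stmt18.KK (X : Set (Fin k → ZMod 2)))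
    (Stmt18.KK_prod _)
    {A : Set (Fin m → ZMod 2) | ∃ φ : (Fin k → ZMod 2) → (Fin m → ZMod 2),
        (∀ a b, hammingDist (φ a) (φ b) = hammingDist a b) ∧ φ '' (X : Set (Fin k → ZMod 2)) = A}
    ⟨m, Equiv.refl _, by
      rintro A ⟨φ, h1, h2⟩
      exact ⟨φ, h1, by rw [h2]; simp⟩⟩ r hr w w' (fun A hA => conv A (hw A hA))
    (fun A hA => conv A (hw' A hA))
    (fun x => by convert hwr x) (fun x => by convert hwm x)
  exact Stmt18.part1 _ hK hT
end
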